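/- (Minimal model theorem) Let k be a field and A an A∞-algebra. Then the homology H*A admits an A∞-algebra structure such that (1) b_1 = 0 and b_2 is induced from the operation b_2 of A, and (2) there is an A∞-quasi-isomorphism A → H*A inducing the identity in homology. Moreover, this A∞-structure on H*A is unique up to (non-unique) A∞-isomorphism. -/

import Mathlib

/-!
# Statement 13 (Minimal model theorem)

Let `k` be a field and `A` an A∞-algebra.  Then the homology `H*A` admits an
A∞-algebra structure such that (1) `b₁ = 0` and `b₂` is induced from the operation
`b₂` of `A`, and (2) there is an A∞-quasi-isomorphism `A → H*A` inducing the identity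
in homology.  Moreover this structure is unique up to (non-unique) A∞-isomorphism.

`H*A` is realized concretely as the direct sum over `p : ℤ` of the quotients
(cycles of degree `p`)/(boundaries of degree `p`) for the differential `b₁`
(which has the same cycles and boundaries as `m₁ = -b₁`).
-/

open Finset Function

namespace Stmt13

variable (k : Type) [Field k]

/-- An `n`-ary operation is `k`-multilinear. -/
def IsMultilinear {M N : Type} [AddCommGroup M] [Module k M] [AddCommGroup N] [Module k N]
    {n : ℕ} (f : (Fin n → M) → N) : Prop :=
  (∀ (v : Fin n → M) (i : Fin n) (x y : M),
      f (Function.update v i (x + y)) = f (Function.update v i x) + f (Function.update v i y)) ∧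
  (∀ (v : Fin n → M) (i : Fin n) (a : k) (x : M),
      f (Function.update v i (a • x)) = a • f (Function.update v i x))

/-- The tuple obtained from `v` by replacing the `j` entries `v_{i+1}, …, v_{i+j}`
by the single entry `x`. -/
def insArg {M : Type} [Zero M] (n i j : ℕ) (v : Fin n → M) (x : M) :
    Fin (i + 1 + (n - i - j)) → M := fun t =>
  if h : (t : ℕ) < i ∧ (t : ℕ) < n then v ⟨t, h.2⟩
  else if (t : ℕ) = i then x
  else if h2 : (t : ℕ) + j - 1 < n then v ⟨(t : ℕ) + j - 1, h2⟩ else 0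

/-- The tuple `(v_{i+1}, …, v_{i+j})`. -/
def shiftArg {M : Type} [Zero M] (n i j : ℕ) (v : Fin n → M) : Fin j → M := fun t =>
  if h : i + (t : ℕ) < n then v ⟨i + t, h⟩ else 0

/-- The Koszul sign exponent `p_1 + ⋯ + p_i`. -/
def partialDeg (n i : ℕ) (p : Fin n → ℤ) : ℤ :=
  ∑ t ∈ Finset.range i, if h : t < n then p ⟨t, h⟩ else 0

/-- `b` is an A∞-algebra structure on the graded space `(M, gr)` (`gr` being the grading of
the suspension `SA`): multilinear operations of degree `1`, defined for `n ≥ 1`, satisfying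
the A∞-relations `∑_{i+j+l=n} b_{i+1+l} ∘ (1^{⊗i} ⊗ b_j ⊗ 1^{⊗l}) = 0` with Koszul signs. -/
def IsAInfinity (M : Type) [AddCommGroup M] [Module k M] (gr : ℤ → Submodule k M)
    (b : ∀ n : ℕ, (Fin n → M) → M) : Prop :=
  b 0 = 0 ∧
  (∀ n, IsMultilinear k (b n)) ∧
  (∀ (n : ℕ) (p : Fin n → ℤ) (v : Fin n → M),
      (∀ t, v t ∈ gr (p t)) → b n v ∈ gr (1 + ∑ t, p t)) ∧
  (∀ (n : ℕ), 1 ≤ n → ∀ (p : Fin n → ℤ) (v : Fin n → M), (∀ t, v t ∈ gr (p t)) →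
      ∑ i ∈ Finset.range n, ∑ j ∈ Finset.Icc 1 (n - i),
        ((-1 : k) ^ partialDeg n i p) •
          b (i + 1 + (n - i - j)) (insArg n i j v (b j (shiftArg n i j v))) = 0)

/-- `f` is a morphism of A∞-algebras from `(M, gr, b)` to `(M', gr', b')`:
a family of multilinear maps `f_n`, `n ≥ 1`, homogeneous of degree `0`, with
`∑_{i+j+l=n} f_{i+1+l} ∘ (1^{⊗i} ⊗ b_j ⊗ 1^{⊗l}) = ∑_{i_1+⋯+i_s=n} b'_s ∘ (f_{i_1} ⊗ ⋯ ⊗ f_{i_s})`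
(Koszul signs; the right-hand sum is over all compositions of `n`). -/
def IsAInfMorphism (M : Type) [AddCommGroup M] [Module k M] (gr : ℤ → Submodule k M)
    (b : ∀ n : ℕ, (Fin n → M) → M)
    (M' : Type) [AddCommGroup M'] [Module k M'] (gr' : ℤ → Submodule k M')
    (b' : ∀ n : ℕ, (Fin n → M') → M')
    (f : ∀ n : ℕ, (Fin n → M) → M') : Prop :=
  f 0 = 0 ∧
  (∀ n, IsMultilinear k (f n)) ∧
  (∀ (n : ℕ) (p : Fin n → ℤ) (v : Fin n → M),
      (∀ t, v t ∈ gr (p t)) → f n v ∈ gr' (∑ t, p t)) ∧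
  (∀ (n : ℕ), 1 ≤ n → ∀ (p : Fin n → ℤ) (v : Fin n → M), (∀ t, v t ∈ gr (p t)) →
      ∑ i ∈ Finset.range n, ∑ j ∈ Finset.Icc 1 (n - i),
        ((-1 : k) ^ partialDeg n i p) •
          f (i + 1 + (n - i - j)) (insArg n i j v (b j (shiftArg n i j v)))
      = ∑ comp : Composition n,
          b' comp.length (fun s => f (comp.blocksFun s) (fun t => v (comp.embedding s t))))

/-- A bundled A∞-algebra over `k` (the grading, which is an internal direct-sum
decomposition, is that of the suspension `SA`). -/
structure AInfAlg where
  M : Type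
  [acg : AddCommGroup M]
  [mod : Module k M]
  gr : ℤ → Submodule k M
  internal : DirectSum.IsInternal gr
  b : ∀ n : ℕ, (Fin n → M) → M
  isAInf : IsAInfinity k M gr b

attribute [instance] AInfAlg.acg AInfAlg.mod

variable {k}

private lemma update_const {M : Type} (v : Fin 1 → M) (z : M) :
    Function.update v 0 z = fun _ => z := by
  funext t
  have ht : t = 0 := Subsingleton.elim _ _
  subst ht
  simp

/-- The differential `b₁` of an A∞-algebra, as a linear map. -/
def d₁ (A : AInfAlg k) : A.M →ₗ[k] A.M where
  toFun x := A.b 1 fun _ => x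
  map_add' x y := by
    have h := (A.isAInf.2.1 1).1 (fun _ => x) 0 x y
    rwa [update_const, update_const, update_const] at h
  map_smul' a x := by
    have h := (A.isAInf.2.1 1).2 (fun _ => x) 0 a x
    rwa [update_const, update_const] at h

/-- Cycles of degree `p` (for the grading of the suspension). -/
def cyc (A : AInfAlg k) (p : ℤ) : Submodule k A.M :=
  A.gr p ⊓ LinearMap.ker (d₁ A)

/-- Boundaries of degree `p`. -/
def bdry (A : AInfAlg k) (p : ℤ) : Submodule k A.M :=
  Submodule.map (d₁ A) (A.gr (p - 1))

/-- The degree-`p` homology of `A`. -/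
def Hp (A : AInfAlg k) (p : ℤ) : Type :=
  ↥(cyc A p) ⧸ Submodule.comap (cyc A p).subtype (bdry A p)

noncomputable instance (A : AInfAlg k) (p : ℤ) : AddCommGroup (Hp A p) :=
  Submodule.Quotient.addCommGroup _

noncomputable instance (A : AInfAlg k) (p : ℤ) : Module k (Hp A p) :=
  Submodule.Quotient.module _

/-- The total homology `H*A` of `A`. -/
abbrev HM (A : AInfAlg k) : Type := DirectSum ℤ (fun p => Hp A p)

/-- The grading of `H*A`. -/
noncomputable def grH (A : AInfAlg k) (p : ℤ) : Submodule k (HM A) :=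
  LinearMap.range (DirectSum.lof k ℤ (fun q => Hp A q) p)

/-- The homology class of a cycle. -/
noncomputable def cls (A : AInfAlg k) (p : ℤ) (x : A.M) (hx : x ∈ cyc A p) : HM A :=
  DirectSum.lof k ℤ (fun q => Hp A q) p (Submodule.Quotient.mk ⟨x, hx⟩)

/-- `bH` is a "minimal model" A∞-structure for `A` on `H*A`: an A∞-structure with
`b₁ = 0`, whose `b₂` is induced by the `b₂` of `A`, together with an
A∞-quasi-isomorphism `A → H*A` inducing the identity in homology. -/
def IsMinimalModelStructure (A : AInfAlg k) (bH : ∀ n : ℕ, (Fin n → HM A) → HM A) : Prop :=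
  IsAInfinity k (HM A) (grH A) bH ∧
  bH 1 = 0 ∧
  (∀ (p q : ℤ) (x y : A.M) (hx : x ∈ cyc A p) (hy : y ∈ cyc A q)
      (hb : A.b 2 ![x, y] ∈ cyc A (p + q + 1)),
      bH 2 ![cls A p x hx, cls A q y hy] = cls A (p + q + 1) (A.b 2 ![x, y]) hb) ∧
  (∃ f : ∀ n : ℕ, (Fin n → A.M) → HM A,
      IsAInfMorphism k A.M A.gr A.b (HM A) (grH A) bH f ∧
      -- `f` induces the identity in homology (`H*A` has zero differential, so this says
      -- that `f₁` sends each cycle to its class):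
      (∀ (p : ℤ) (x : A.M) (hx : x ∈ cyc A p), f 1 (fun _ => x) = cls A p x hx))

open scoped TensorProduct

section TensorWords

variable {M : Type} [AddCommGroup M] [Module k M]

/-- The tensor word `x₁ ⊗ ⋯ ⊗ xₙ` spelled by a list. -/
noncomputable def word (l : List M) : TensorAlgebra k M :=
  (l.map (TensorAlgebra.ι k)).prod

@[simp] lemma word_nil : word (k := k) ([] : List M) = 1 := rfl

@[simp] lemma word_cons (x : M) (l : List M) :
    word (k := k) (x :: l) = TensorAlgebra.ι k x * word l := by
  simp [word]

lemma word_append (l l' : List M) : word (k := k) (l ++ l') = word l * word l' := by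
  simp [word]

lemma word_singleton (x : M) : word (k := k) [x] = TensorAlgebra.ι k x := by simp

lemma word_ofFn {n : ℕ} (v : Fin n → M) :
    word (k := k) (List.ofFn v) = TensorAlgebra.tprod k M n v := by
  simp [word, TensorAlgebra.tprod_apply, List.map_ofFn, Function.comp_def]

lemma tensor_induction {P : TensorAlgebra k M → Prop} (one : P 1)
    (cons : ∀ x w, P w → P (TensorAlgebra.ι k x * w))
    (add : ∀ v w, P v → P w → P (v + w)) (smul : ∀ (a : k) w, P w → P (a • w)) (w) : P w := by
  have key : ∀ v : TensorAlgebra k M, ∀ w, P w → P (v * w) := by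
    intro v
    induction v using TensorAlgebra.induction with
    | algebraMap r => intro w hw; rw [← Algebra.smul_def]; exact smul r w hw
    | ι x => exact cons x
    | mul a b ha hb => intro w hw; rw [mul_assoc]; exact ha _ (hb _ hw)
    | add a b ha hb => intro w hw; rw [add_mul]; exact add _ _ (ha _ hw) (hb _ hw)
  simpa using key w 1 one

variable {N : Type} [AddCommGroup N] [Module k N]

lemma tensor_ext {φ ψ : TensorAlgebra k M →ₗ[k] N} (one : φ 1 = ψ 1)
    (cons : ∀ x w, φ w = ψ w → φ (TensorAlgebra.ι k x * w) = ψ (TensorAlgebra.ι k x * w)) :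
    φ = ψ := by
  ext w
  induction w using tensor_induction with
  | one => exact one
  | cons x w h => exact cons x w h
  | add v w hv hw => rw [map_add, map_add, hv, hw]
  | smul a w hw => rw [map_smul, map_smul, hw]

lemma word_ext {φ ψ : TensorAlgebra k M →ₗ[k] N}
    (h : ∀ l : List M, φ (word l) = ψ (word l)) : φ = ψ := by
  have key : ∀ w : TensorAlgebra k M,
      w ∈ Submodule.span k (Set.range (word (k := k) (M := M))) := by
    intro w
    induction w using tensor_induction with
    | one => exact Submodule.subset_span ⟨[], rfl⟩
    | cons x w hw =>
      induction hw using Submodule.span_induction with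
      | mem w hw =>
        obtain ⟨l, rfl⟩ := hw
        exact Submodule.subset_span ⟨x :: l, by simp⟩
      | zero => simp
      | add a b _ _ ha hb => rw [mul_add]; exact add_mem ha hb
      | smul r a _ ha => rw [mul_smul_comm]; exact Submodule.smul_mem _ _ ha
    | add v w hv hw => exact add_mem hv hw
    | smul a w hw => exact Submodule.smul_mem _ _ hw
  ext w
  induction key w using Submodule.span_induction with
  | mem w hw => obtain ⟨l, rfl⟩ := hw; exact h l
  | zero => simp
  | add a b _ _ ha hb => rw [map_add, map_add, ha, hb]
  | smul r a _ ha => rw [map_smul, map_smul, ha]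

/-- The linear map on the tensor algebra with prescribed multilinear components. -/
noncomputable def assemble (f : ∀ n : ℕ, MultilinearMap k (fun _ : Fin n => M) N) :
    TensorAlgebra k M →ₗ[k] N :=
  (DirectSum.toModule k ℕ N fun n => PiTensorProduct.lift (f n)) ∘ₗ
    (TensorAlgebra.toDirectSum (R := k) (M := M)).toLinearMap

lemma assemble_word (f : ∀ n : ℕ, MultilinearMap k (fun _ : Fin n => M) N) {n : ℕ}
    (v : Fin n → M) : assemble f (word (List.ofFn v)) = f n v := by
  rw [word_ofFn]
  simp only [assemble, LinearMap.comp_apply, AlgHom.toLinearMap_apply]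
  rw [TensorAlgebra.toDirectSum_tensorPower_tprod, ← DirectSum.lof_eq_of k,
    DirectSum.toModule_lof, PiTensorProduct.lift.tprod]

/-- `φ` vanishes on words of length less than `n`. -/
def VanishesBelow (n : ℕ) (φ : TensorAlgebra k M →ₗ[k] N) : Prop :=
  ∀ l : List M, l.length < n → φ (word l) = 0

lemma VanishesBelow.add {n : ℕ} {φ ψ : TensorAlgebra k M →ₗ[k] N}
    (hφ : VanishesBelow n φ) (hψ : VanishesBelow n ψ) : VanishesBelow n (φ + ψ) := by
  intro l hl; simp [hφ l hl, hψ l hl]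

lemma VanishesBelow.sub {n : ℕ} {φ ψ : TensorAlgebra k M →ₗ[k] N}
    (hφ : VanishesBelow n φ) (hψ : VanishesBelow n ψ) : VanishesBelow n (φ - ψ) := by
  intro l hl; simp [hφ l hl, hψ l hl]

lemma VanishesBelow.neg {n : ℕ} {φ : TensorAlgebra k M →ₗ[k] N}
    (hφ : VanishesBelow n φ) : VanishesBelow n (-φ) := by
  intro l hl; simp [hφ l hl]

lemma VanishesBelow.mono {m n : ℕ} (h : m ≤ n) {φ : TensorAlgebra k M →ₗ[k] N}
    (hφ : VanishesBelow n φ) : VanishesBelow m φ :=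
  fun l hl => hφ l (hl.trans_le h)

lemma eq_zero_of_vanishesBelow {φ : TensorAlgebra k M →ₗ[k] N}
    (h : ∀ n, VanishesBelow n φ) : φ = 0 :=
  word_ext fun l => by simpa using h (l.length + 1) l (by omega)

lemma exists_limit (s : ℕ → TensorAlgebra k M →ₗ[k] N)
    (hs : ∀ n, VanishesBelow n (s (n + 1) - s n)) :
    ∃ φ : TensorAlgebra k M →ₗ[k] N, (∀ n, VanishesBelow n (φ - s n)) ∧
      ∀ l : List M, φ (word l) = s (l.length + 1) (word l) := by
  have hst : ∀ m n, VanishesBelow n (s (n + m) - s n) := by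
    intro m n
    induction m with
    | zero => intro l _; simp
    | succ m ih =>
      have := ((hs (n + m)).mono (Nat.le_add_right n m)).add ih
      rwa [sub_add_sub_cancel] at this
  let φ := assemble fun n => (s (n + 1)).compMultilinearMap (TensorAlgebra.tprod k M n)
  have hφ : ∀ l : List M, φ (word l) = s (l.length + 1) (word l) := by
    intro l
    conv_lhs => rw [← List.ofFn_get l]
    rw [assemble_word]
    simp only [LinearMap.compMultilinearMap_apply]
    rw [← word_ofFn, List.ofFn_get]
  refine ⟨φ, fun n l hl => ?_, hφ⟩
  obtain ⟨m, rfl⟩ := Nat.exists_eq_add_of_le (Nat.succ_le_of_lt hl)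
  have := hst m (l.length + 1) l (by omega)
  rw [LinearMap.sub_apply, sub_eq_zero] at this ⊢
  rw [hφ, Nat.succ_eq_add_one, this]

end TensorWords

section Convolution

variable {M : Type} [AddCommGroup M] [Module k M]

/-- The operator from which `deconc` is obtained by iteration along the letters of a word. -/
noncomputable def deconcStep :
    M →ₗ[k] Module.End k ((TensorAlgebra k M ⊗[k] TensorAlgebra k M) × TensorAlgebra k M) :=
  LinearMap.mk₂ k
    (fun x p => (1 ⊗ₜ (TensorAlgebra.ι k x * p.2) + (TensorAlgebra.ι k x ⊗ₜ 1) * p.1,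
      TensorAlgebra.ι k x * p.2))
    (by intro x y p; ext <;> simp [add_mul, TensorProduct.tmul_add, TensorProduct.add_tmul]; abel)
    (by intro a x p; ext <;> simp [← TensorProduct.smul_tmul'])
    (by intro x p q; ext <;> simp [mul_add, TensorProduct.tmul_add]; abel)
    (by intro a x p; ext <;> simp)

/-- Deconcatenation of tensor words. -/
noncomputable def deconc :
    TensorAlgebra k M →ₗ[k] TensorAlgebra k M ⊗[k] TensorAlgebra k M :=
  LinearMap.fst k _ _ ∘ₗ LinearMap.applyₗ (1 ⊗ₜ 1, 1) ∘ₗ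
    (TensorAlgebra.lift k (deconcStep (k := k) (M := M))).toLinearMap

lemma deconcStep_apply (x : M)
    (p : (TensorAlgebra k M ⊗[k] TensorAlgebra k M) × TensorAlgebra k M) :
    deconcStep x p = (1 ⊗ₜ (TensorAlgebra.ι k x * p.2) + (TensorAlgebra.ι k x ⊗ₜ 1) * p.1,
      TensorAlgebra.ι k x * p.2) := rfl

lemma deconc_one : deconc (1 : TensorAlgebra k M) = 1 ⊗ₜ 1 := by
  simp [deconc]

lemma deconcStep_snd (w : TensorAlgebra k M) :
    (TensorAlgebra.lift k (deconcStep (k := k) (M := M)) w (1 ⊗ₜ 1, 1)).2 = w := by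
  induction w using tensor_induction with
  | one => simp
  | cons x w h => simp [deconcStep_apply, h]
  | add v w hv hw => simp [hv, hw]
  | smul a w hw => simp [hw]

lemma deconc_cons (x : M) (w : TensorAlgebra k M) :
    deconc (TensorAlgebra.ι k x * w) =
      1 ⊗ₜ (TensorAlgebra.ι k x * w) + (TensorAlgebra.ι k x ⊗ₜ 1) * deconc w := by
  have h := deconcStep_snd w
  simp only [deconc, LinearMap.comp_apply, AlgHom.toLinearMap_apply, LinearMap.applyₗ_apply_apply,
    map_mul, TensorAlgebra.lift_ι_apply, Module.End.mul_apply, LinearMap.fst_apply]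
  simp [deconcStep_apply, h]

variable {R : Type} [Ring R] [Algebra k R]

/-- Convolution of linear maps on tensor words with values in an algebra. -/
noncomputable def conv (φ ψ : TensorAlgebra k M →ₗ[k] R) : TensorAlgebra k M →ₗ[k] R :=
  LinearMap.mul' k R ∘ₗ TensorProduct.map φ ψ ∘ₗ deconc

infixl:70 " ⋆ " => conv

/-- The unit for convolution. -/
noncomputable def convOne : TensorAlgebra k M →ₗ[k] R :=
  Algebra.linearMap k R ∘ₗ (TensorAlgebra.algebraMapInv (R := k) (M := M)).toLinearMap

@[simp] lemma convOne_one : convOne (1 : TensorAlgebra k M) = (1 : R) := by simp [convOne]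

@[simp] lemma convOne_cons (x : M) (w : TensorAlgebra k M) :
    convOne (TensorAlgebra.ι k x * w) = (0 : R) := by
  simp [convOne, TensorAlgebra.algebraMapInv]

@[simp] lemma conv_apply_one (φ ψ : TensorAlgebra k M →ₗ[k] R) : (φ ⋆ ψ) 1 = φ 1 * ψ 1 := by
  simp [conv, deconc_one]

lemma conv_apply_cons (φ ψ : TensorAlgebra k M →ₗ[k] R) (x : M) (w : TensorAlgebra k M) :
    (φ ⋆ ψ) (TensorAlgebra.ι k x * w) = φ 1 * ψ (TensorAlgebra.ι k x * w) +
      ((φ ∘ₗ LinearMap.mulLeft k (TensorAlgebra.ι k x)) ⋆ ψ) w := by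
  simp only [conv, LinearMap.comp_apply, deconc_cons, map_add, TensorProduct.map_tmul,
    LinearMap.mul'_apply]
  congr 1
  generalize deconc w = t
  induction t using TensorProduct.induction_on with
  | zero => simp
  | tmul a b => simp
  | add a b ha hb => rw [mul_add, map_add, map_add, ha, hb, map_add, map_add]

lemma conv_apply_word (φ ψ : TensorAlgebra k M →ₗ[k] R) (l : List M) :
    (φ ⋆ ψ) (word l) = ∑ i ∈ Finset.range (l.length + 1),
      φ (word (l.take i)) * ψ (word (l.drop i)) := by
  induction l generalizing φ with
  | nil => simp
  | cons x l ih =>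
    rw [word_cons, conv_apply_cons, ih, List.length_cons,
      Finset.sum_range_succ' _ (l.length + 1), add_comm]
    simp

@[simp] lemma conv_add (φ ψ χ : TensorAlgebra k M →ₗ[k] R) : φ ⋆ (ψ + χ) = φ ⋆ ψ + φ ⋆ χ := by
  refine word_ext fun l => ?_
  simp [conv_apply_word, mul_add, Finset.sum_add_distrib]

@[simp] lemma add_conv (φ ψ χ : TensorAlgebra k M →ₗ[k] R) : (φ + ψ) ⋆ χ = φ ⋆ χ + ψ ⋆ χ := by
  refine word_ext fun l => ?_
  simp [conv_apply_word, add_mul, Finset.sum_add_distrib]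

@[simp] lemma conv_neg (φ ψ : TensorAlgebra k M →ₗ[k] R) : φ ⋆ (-ψ) = -(φ ⋆ ψ) := by
  refine word_ext fun l => ?_
  simp [conv_apply_word]

@[simp] lemma neg_conv (φ ψ : TensorAlgebra k M →ₗ[k] R) : (-φ) ⋆ ψ = -(φ ⋆ ψ) := by
  refine word_ext fun l => ?_
  simp [conv_apply_word]

@[simp] lemma conv_sub (φ ψ χ : TensorAlgebra k M →ₗ[k] R) : φ ⋆ (ψ - χ) = φ ⋆ ψ - φ ⋆ χ := by
  simp [sub_eq_add_neg]

@[simp] lemma sub_conv (φ ψ χ : TensorAlgebra k M →ₗ[k] R) : (φ - ψ) ⋆ χ = φ ⋆ χ - ψ ⋆ χ := by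
  simp [sub_eq_add_neg]

@[simp] lemma zero_conv (φ : TensorAlgebra k M →ₗ[k] R) : 0 ⋆ φ = 0 :=
  word_ext fun l => by simp [conv_apply_word]

lemma const_mul_conv (a : R) (φ ψ : TensorAlgebra k M →ₗ[k] R) (w : TensorAlgebra k M) :
    ((LinearMap.mulLeft k a ∘ₗ φ) ⋆ ψ) w = a * (φ ⋆ ψ) w := by
  have : (LinearMap.mulLeft k a ∘ₗ φ) ⋆ ψ = LinearMap.mulLeft k a ∘ₗ (φ ⋆ ψ) :=
    word_ext fun l => by simp [conv_apply_word, mul_assoc]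
  rw [this]; rfl

lemma conv_assoc (φ ψ χ : TensorAlgebra k M →ₗ[k] R) : φ ⋆ ψ ⋆ χ = φ ⋆ (ψ ⋆ χ) := by
  refine word_ext fun l => ?_
  induction l generalizing φ with
  | nil => simp [mul_assoc]
  | cons x l ih =>
    have key : (φ ⋆ ψ) ∘ₗ LinearMap.mulLeft k (TensorAlgebra.ι k x) =
        LinearMap.mulLeft k (φ 1) ∘ₗ (ψ ∘ₗ LinearMap.mulLeft k (TensorAlgebra.ι k x)) +
        (φ ∘ₗ LinearMap.mulLeft k (TensorAlgebra.ι k x)) ⋆ ψ := by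
      ext w
      simp [conv_apply_cons]
    rw [word_cons, conv_apply_cons, key, add_conv, LinearMap.add_apply, ih, const_mul_conv,
      conv_apply_cons, conv_apply_cons, conv_apply_one]
    rw [mul_add, mul_assoc, add_assoc]

@[simp] lemma convOne_conv (φ : TensorAlgebra k M →ₗ[k] R) : convOne ⋆ φ = φ := by
  refine tensor_ext (by simp) fun x w _ => ?_
  have : (convOne : TensorAlgebra k M →ₗ[k] R) ∘ₗ
      LinearMap.mulLeft k (TensorAlgebra.ι k x) = 0 := by
    ext w; simp
  simp [conv_apply_cons, this]

@[simp] lemma conv_convOne (φ : TensorAlgebra k M →ₗ[k] R) : φ ⋆ convOne = φ := by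
  refine word_ext fun l => ?_
  induction l generalizing φ with
  | nil => simp
  | cons x l ih => simp [conv_apply_cons, ih]

lemma map_conv {S : Type} [Ring S] [Algebra k S] (τ : R →ₐ[k] S)
    (φ ψ : TensorAlgebra k M →ₗ[k] R) :
    τ.toLinearMap ∘ₗ (φ ⋆ ψ) = (τ.toLinearMap ∘ₗ φ) ⋆ (τ.toLinearMap ∘ₗ ψ) :=
  word_ext fun l => by simp [conv_apply_word]

lemma map_convOne {S : Type} [Ring S] [Algebra k S] (τ : R →ₐ[k] S) :
    τ.toLinearMap ∘ₗ (convOne : TensorAlgebra k M →ₗ[k] R) = convOne := by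
  ext w; simp [convOne]

lemma vanishesBelow_conv {m n : ℕ} {φ ψ : TensorAlgebra k M →ₗ[k] R}
    (hφ : VanishesBelow m φ) (hψ : VanishesBelow n ψ) : VanishesBelow (m + n) (φ ⋆ ψ) := by
  intro l hl
  rw [conv_apply_word]
  refine Finset.sum_eq_zero fun i hi => ?_
  rw [Finset.mem_range] at hi
  by_cases h : i < m
  · rw [hφ _ (by simp; omega), zero_mul]
  · rw [hψ _ (by simp; omega), mul_zero]

/-- Every map vanishing on the empty word can be summed to a geometric series for convolution. -/
lemma exists_geometric (g : TensorAlgebra k M →ₗ[k] R) (hg : g 1 = 0) :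
    ∃ G, (convOne - g) ⋆ G = convOne := by
  have hg1 : VanishesBelow 1 g := by
    intro l hl
    have : l = [] := List.length_eq_zero_iff.1 (by omega)
    simpa [this] using hg
  let s : ℕ → TensorAlgebra k M →ₗ[k] R := fun n => Nat.rec 0 (fun _ G => convOne + g ⋆ G) n
  have hs : ∀ n, s (n + 1) = convOne + g ⋆ s n := fun n => rfl
  have hstep : ∀ n, VanishesBelow n (s (n + 1) - s n) := by
    intro n
    induction n with
    | zero => intro l hl; omega
    | succ n ih =>
      have : s (n + 1 + 1) - s (n + 1) = g ⋆ (s (n + 1) - s n) := by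
        rw [hs (n + 1), hs n, conv_sub]; abel
      rw [this]
      exact (vanishesBelow_conv hg1 ih).mono (by omega)
  obtain ⟨G, hG, -⟩ := exists_limit s hstep
  refine ⟨G, ?_⟩
  rw [sub_conv, convOne_conv, sub_eq_iff_eq_add, ← sub_eq_zero]
  refine eq_zero_of_vanishesBelow fun n => ?_
  have h : G - (convOne + g ⋆ G) = (G - s (n + 1)) - g ⋆ (G - s n) := by
    rw [hs, conv_sub]; abel
  rw [h]
  exact ((hG (n + 1)).mono (Nat.le_succ n)).sub
    ((vanishesBelow_conv hg1 (hG n)).mono (by omega))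

lemma one_sub_conv_eq_iff {g φ ψ : TensorAlgebra k M →ₗ[k] R} :
    (convOne - g) ⋆ φ = ψ ↔ φ = ψ + g ⋆ φ := by
  rw [sub_conv, convOne_conv, sub_eq_iff_eq_add]

lemma geometric_comm {g G : TensorAlgebra k M →ₗ[k] R} (hg : g 1 = 0)
    (h : (convOne - g) ⋆ G = convOne) : G ⋆ (convOne - g) = convOne := by
  have hG : (convOne - G : TensorAlgebra k M →ₗ[k] R) 1 = 0 := by
    have := LinearMap.congr_fun h 1
    simp [hg] at this
    simp [this]
  obtain ⟨K, hK⟩ := exists_geometric (convOne - G) hG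
  rw [sub_sub_cancel] at hK
  have : convOne - g = K :=
    calc convOne - g = (convOne - g) ⋆ (G ⋆ K) := by rw [hK, conv_convOne]
      _ = K := by rw [← conv_assoc, h, convOne_conv]
  rw [this, hK]

lemma geometric_unique {g G G' : TensorAlgebra k M →ₗ[k] R} (hg : g 1 = 0)
    (h : (convOne - g) ⋆ G = convOne) (h' : (convOne - g) ⋆ G' = convOne) : G = G' := by
  rw [← convOne_conv G', ← geometric_comm hg h, conv_assoc, h', conv_convOne]

end Convolution

section Coalgebra

open scoped TensorProduct

variable {M N P : Type} [AddCommGroup M] [Module k M] [AddCommGroup N] [Module k N]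
  [AddCommGroup P] [Module k P]

/-- The counit of the tensor coalgebra. -/
noncomputable def counit : TensorAlgebra k M →ₐ[k] k := TensorAlgebra.algebraMapInv

/-- The projection of the tensor coalgebra onto its cogenerators. -/
noncomputable def proj : TensorAlgebra k M →ₗ[k] M := TensorAlgebra.ιInv

@[simp] lemma counit_ι (x : M) : counit (TensorAlgebra.ι k x) = 0 := by
  simp [counit, TensorAlgebra.algebraMapInv]

lemma convOne_eq_counit :
    (convOne : TensorAlgebra k M →ₗ[k] k) = counit.toLinearMap := by
  ext w; simp [convOne, counit]

@[simp] lemma proj_one : proj (1 : TensorAlgebra k M) = 0 := by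
  let : Module kᵐᵒᵖ M := Module.compHom _ ((RingHom.id k).fromOpposite mul_comm)
  have : IsCentralScalar k M := ⟨fun r m => rfl⟩
  change (TensorAlgebra.toTrivSqZeroExt (R := k) (M := M) 1).snd = _
  simp

lemma proj_cons (x : M) (w : TensorAlgebra k M) :
    proj (TensorAlgebra.ι k x * w) = counit w • x := by
  let : Module kᵐᵒᵖ M := Module.compHom _ ((RingHom.id k).fromOpposite mul_comm)
  have : IsCentralScalar k M := ⟨fun r m => rfl⟩
  have h : ∀ w : TensorAlgebra k M,
      (TensorAlgebra.toTrivSqZeroExt (R := k) (M := M) w).fst = counit w := by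
    intro w
    induction w using tensor_induction with
    | one => simp
    | cons x w h => simp
    | add v w hv hw => simp [hv, hw]
    | smul a w hw => simp [hw]
  change (TensorAlgebra.toTrivSqZeroExt (R := k) (M := M) (TensorAlgebra.ι k x * w)).snd = _
  simp [h]

@[simp] lemma proj_ι (x : M) : proj (TensorAlgebra.ι k x) = x := by
  simpa using proj_cons x (1 : TensorAlgebra k M)

lemma proj_mul (v w : TensorAlgebra k M) :
    proj (v * w) = counit v • proj w + counit w • proj v := by
  induction v using tensor_induction with
  | one => simp
  | cons x v h => simp [mul_assoc, proj_cons, smul_smul, mul_comm]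
  | add v v' h h' => rw [add_mul, map_add, h, h', map_add, map_add]; module
  | smul a v h => rw [smul_mul_assoc, map_smul, h, map_smul, map_smul]; module

lemma counit_word (l : List M) : counit (word (k := k) l) = if l = [] then 1 else 0 := by
  cases l <;> simp

lemma counit_eq_of_convOne {X : TensorAlgebra k M →ₗ[k] TensorAlgebra k N}
    (h : counit.toLinearMap ∘ₗ X = counit.toLinearMap) (w) : counit (X w) = counit w :=
  LinearMap.congr_fun h w

lemma proj_conv_left {X Y : TensorAlgebra k M →ₗ[k] TensorAlgebra k N}
    (hX : counit.toLinearMap ∘ₗ X = counit.toLinearMap) (hY : counit.toLinearMap ∘ₗ Y = 0) :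
    proj ∘ₗ (X ⋆ Y) = proj ∘ₗ Y := by
  refine word_ext fun l => ?_
  have hY' : ∀ w, counit (Y w) = 0 := LinearMap.congr_fun hY
  simp only [LinearMap.comp_apply, conv_apply_word, map_sum, proj_mul, hY', zero_smul, add_zero,
    counit_eq_of_convOne hX, counit_word]
  rw [Finset.sum_eq_single 0]
  · simp
  · intro i hi h0
    rw [Finset.mem_range] at hi
    rw [if_neg, zero_smul]
    intro h
    rw [List.take_eq_nil_iff] at h
    rcases h with h | h
    · exact h0 h
    · subst h; simp at hi; omega
  · simp

lemma proj_conv_right {X Y : TensorAlgebra k M →ₗ[k] TensorAlgebra k N}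
    (hX : counit.toLinearMap ∘ₗ X = counit.toLinearMap) (hY : counit.toLinearMap ∘ₗ Y = 0) :
    proj ∘ₗ (Y ⋆ X) = proj ∘ₗ Y := by
  refine word_ext fun l => ?_
  have hY' : ∀ w, counit (Y w) = 0 := LinearMap.congr_fun hY
  simp only [LinearMap.comp_apply, conv_apply_word, map_sum, proj_mul, hY', zero_smul, zero_add,
    counit_eq_of_convOne hX, counit_word]
  rw [Finset.sum_eq_single l.length]
  · simp
  · intro i hi h0
    rw [Finset.mem_range] at hi
    rw [if_neg, zero_smul]
    rw [List.drop_eq_nil_iff]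
    omega
  · simp

lemma counit_ι_conv (X : TensorAlgebra k M →ₗ[k] TensorAlgebra k N)
    (e : TensorAlgebra k M →ₗ[k] N) :
    counit.toLinearMap ∘ₗ ((TensorAlgebra.ι k ∘ₗ e) ⋆ X) = 0 :=
  word_ext fun l => by simp [conv_apply_word]

lemma proj_conv_ι_conv {X Y : TensorAlgebra k M →ₗ[k] TensorAlgebra k N}
    (hX : counit.toLinearMap ∘ₗ X = counit.toLinearMap)
    (hY : counit.toLinearMap ∘ₗ Y = counit.toLinearMap) (e : TensorAlgebra k M →ₗ[k] N) :
    proj ∘ₗ (X ⋆ ((TensorAlgebra.ι k ∘ₗ e) ⋆ Y)) = e := by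
  rw [proj_conv_left hX (counit_ι_conv _ _), proj_conv_right hY]
  · ext w; simp
  · ext w; simp

/-- The map of tensor words induced by a linear map of letters. -/
noncomputable def mapT (a : M →ₗ[k] N) : TensorAlgebra k M →ₗ[k] TensorAlgebra k N :=
  (TensorAlgebra.lift k (TensorAlgebra.ι k ∘ₗ a)).toLinearMap

@[simp] lemma mapT_one (a : M →ₗ[k] N) : mapT a 1 = 1 := by simp [mapT]

@[simp] lemma mapT_ι (a : M →ₗ[k] N) (x : M) :
    mapT a (TensorAlgebra.ι k x) = TensorAlgebra.ι k (a x) := by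
  simp [mapT]

@[simp] lemma mapT_cons (a : M →ₗ[k] N) (x : M) (w : TensorAlgebra k M) :
    mapT a (TensorAlgebra.ι k x * w) = TensorAlgebra.ι k (a x) * mapT a w := by
  simp [mapT]

lemma mapT_comp (a : N →ₗ[k] P) (b : M →ₗ[k] N) : mapT a ∘ₗ mapT b = mapT (a ∘ₗ b) :=
  tensor_ext (by simp) fun x w h => by
    simp only [LinearMap.comp_apply] at h
    simp [h]

lemma mapT_id : mapT (LinearMap.id : M →ₗ[k] M) = LinearMap.id :=
  tensor_ext (by simp) fun x w h => by simp [h]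

lemma mapT_conv (a : N →ₗ[k] P) (φ ψ : TensorAlgebra k M →ₗ[k] TensorAlgebra k N) :
    mapT a ∘ₗ (φ ⋆ ψ) = (mapT a ∘ₗ φ) ⋆ (mapT a ∘ₗ ψ) :=
  map_conv (TensorAlgebra.lift k (TensorAlgebra.ι k ∘ₗ a)) φ ψ

lemma mapT_comp_ι (a : N →ₗ[k] P) (f : TensorAlgebra k M →ₗ[k] N) :
    mapT a ∘ₗ (TensorAlgebra.ι k ∘ₗ f) = TensorAlgebra.ι k ∘ₗ (a ∘ₗ f) := by
  ext w; simp

lemma counit_mapT (a : M →ₗ[k] N) :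
    counit.toLinearMap ∘ₗ mapT a = counit.toLinearMap :=
  tensor_ext (by simp) fun x w h => by simp

lemma letter_conv_apply_cons (g : M →ₗ[k] N)
    (ψ : TensorAlgebra k M →ₗ[k] TensorAlgebra k N) (x : M) (w : TensorAlgebra k M) :
    ((TensorAlgebra.ι k ∘ₗ (g ∘ₗ proj)) ⋆ ψ) (TensorAlgebra.ι k x * w) =
      TensorAlgebra.ι k (g x) * ψ w := by
  have : (TensorAlgebra.ι k ∘ₗ (g ∘ₗ proj)) ∘ₗ LinearMap.mulLeft k (TensorAlgebra.ι k x) =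
      LinearMap.mulLeft k (TensorAlgebra.ι k (g x)) ∘ₗ convOne := by
    ext w
    simp [proj_cons, convOne, counit, Algebra.algebraMap_eq_smul_one]
  rw [conv_apply_cons, this, const_mul_conv]
  simp

lemma mapT_geometric (a : M →ₗ[k] N) :
    (convOne - TensorAlgebra.ι k ∘ₗ (a ∘ₗ proj)) ⋆ mapT a = convOne :=
  tensor_ext (by simp) fun x w _ => by
    rw [sub_conv, LinearMap.sub_apply, letter_conv_apply_cons]; simp

/-- The coalgebra map of tensor words cogenerated by `f` (which should vanish on the empty
word). -/
noncomputable def cogen (f : TensorAlgebra k M →ₗ[k] N) :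
    TensorAlgebra k M →ₗ[k] TensorAlgebra k N :=
  open Classical in
  if h : f 1 = 0 then (exists_geometric (TensorAlgebra.ι k ∘ₗ f) (by simp [h])).choose else 0

lemma cogen_geometric {f : TensorAlgebra k M →ₗ[k] N} (hf : f 1 = 0) :
    (convOne - TensorAlgebra.ι k ∘ₗ f) ⋆ cogen f = convOne := by
  rw [cogen, dif_pos hf]
  exact (exists_geometric (TensorAlgebra.ι k ∘ₗ f) (by simp [hf])).choose_spec

lemma cogen_geometric' {f : TensorAlgebra k M →ₗ[k] N} (hf : f 1 = 0) :
    cogen f ⋆ (convOne - TensorAlgebra.ι k ∘ₗ f) = convOne :=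
  geometric_comm (by simp [hf]) (cogen_geometric hf)

lemma eq_cogen {f : TensorAlgebra k M →ₗ[k] N} (hf : f 1 = 0)
    {F : TensorAlgebra k M →ₗ[k] TensorAlgebra k N}
    (h : (convOne - TensorAlgebra.ι k ∘ₗ f) ⋆ F = convOne) : F = cogen f :=
  geometric_unique (by simp [hf]) h (cogen_geometric hf)

lemma cogen_rec {f : TensorAlgebra k M →ₗ[k] N} (hf : f 1 = 0) :
    cogen f = convOne + (TensorAlgebra.ι k ∘ₗ f) ⋆ cogen f := by
  have := cogen_geometric hf
  rw [sub_conv, convOne_conv, sub_eq_iff_eq_add] at this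
  exact this

lemma mapT_eq_cogen (a : M →ₗ[k] N) : mapT a = cogen (a ∘ₗ proj) :=
  eq_cogen (by simp) (mapT_geometric a)

lemma cogen_proj : cogen (proj : TensorAlgebra k M →ₗ[k] M) = LinearMap.id := by
  rw [← mapT_id, mapT_eq_cogen, LinearMap.id_comp]

lemma counit_cogen {f : TensorAlgebra k M →ₗ[k] N} (hf : f 1 = 0) :
    counit.toLinearMap ∘ₗ cogen f = counit.toLinearMap := by
  rw [cogen_rec hf, LinearMap.comp_add, counit_ι_conv, map_convOne, add_zero, convOne_eq_counit]

lemma cogen_one {f : TensorAlgebra k M →ₗ[k] N} (hf : f 1 = 0) : cogen f 1 = 1 := by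
  rw [cogen_rec hf]; simp [hf]

lemma proj_cogen {f : TensorAlgebra k M →ₗ[k] N} (hf : f 1 = 0) : proj ∘ₗ cogen f = f := by
  rw [cogen_rec hf, LinearMap.comp_add, proj_conv_right (counit_cogen hf)]
  · ext w; simp [convOne, Algebra.algebraMap_eq_smul_one]
  · ext w; simp

/-- Comparison of two cogenerated maps. -/
lemma cogen_sub {f g : TensorAlgebra k M →ₗ[k] N} (hf : f 1 = 0) (hg : g 1 = 0) :
    cogen f - cogen g = cogen g ⋆ ((TensorAlgebra.ι k ∘ₗ (f - g)) ⋆ cogen f) := by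
  have h : TensorAlgebra.ι k ∘ₗ (f - g) =
      (convOne - TensorAlgebra.ι k ∘ₗ g) - (convOne - TensorAlgebra.ι k ∘ₗ f) := by
    rw [LinearMap.comp_sub]; abel
  rw [h, sub_conv, cogen_geometric hf, conv_sub, ← conv_assoc, cogen_geometric' hg]
  simp

section Comultiplicative

local notation "inl" => AlgHom.toLinearMap (Algebra.TensorProduct.includeLeft (R := k) (S := k))
local notation "inr" => AlgHom.toLinearMap (Algebra.TensorProduct.includeRight (R := k))

lemma deconc_comp_ι_conv (g : TensorAlgebra k M →ₗ[k] N)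
    (ψ : TensorAlgebra k M →ₗ[k] TensorAlgebra k N) :
    deconc ∘ₗ ((TensorAlgebra.ι k ∘ₗ g) ⋆ ψ) =
      inr ∘ₗ ((TensorAlgebra.ι k ∘ₗ g) ⋆ ψ) +
        (inl ∘ₗ (TensorAlgebra.ι k ∘ₗ g)) ⋆ (deconc ∘ₗ ψ) :=
  word_ext fun l => by
    simp [conv_apply_word, deconc_cons, Finset.sum_add_distrib, TensorProduct.tmul_sum]

lemma deconc_cogen {f : TensorAlgebra k M →ₗ[k] N} (hf : f 1 = 0) :
    deconc ∘ₗ cogen f = (inl ∘ₗ cogen f) ⋆ (inr ∘ₗ cogen f) := by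
  have h1 : (convOne - inl ∘ₗ (TensorAlgebra.ι k ∘ₗ f)) ⋆ (deconc ∘ₗ cogen f) =
      inr ∘ₗ cogen f := by
    have hone : deconc ∘ₗ (convOne : TensorAlgebra k M →ₗ[k] TensorAlgebra k N) =
        inr ∘ₗ convOne := by
      ext w
      simp [convOne, Algebra.algebraMap_eq_smul_one, deconc_one]
    have h := congrArg (deconc ∘ₗ ·) (cogen_rec hf)
    have h' := congrArg
      ((inr : TensorAlgebra k N →ₗ[k] TensorAlgebra k N ⊗[k] TensorAlgebra k N) ∘ₗ ·) (cogen_rec hf)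
    simp only [LinearMap.comp_add] at h h'
    rw [deconc_comp_ι_conv, hone] at h
    rw [one_sub_conv_eq_iff, h']
    exact h.trans (add_assoc _ _ _).symm
  have h2 : (inl ∘ₗ cogen f) ⋆ (convOne - inl ∘ₗ (TensorAlgebra.ι k ∘ₗ f)) =
      (convOne : TensorAlgebra k M →ₗ[k] TensorAlgebra k N ⊗[k] TensorAlgebra k N) := by
    rw [← map_convOne Algebra.TensorProduct.includeLeft, ← LinearMap.comp_sub, ← map_conv,
      cogen_geometric' hf]
  rw [← h1, ← conv_assoc, h2, convOne_conv]

lemma deconc_eq : (deconc : TensorAlgebra k M →ₗ[k] _) = inl ⋆ inr := by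
  have := deconc_cogen (proj_one (k := k) (M := M))
  rwa [cogen_proj, LinearMap.comp_id, LinearMap.comp_id, LinearMap.comp_id] at this

variable {R : Type} [Ring R] [Algebra k R]

lemma mul_map_inl_conv_inr (φ ψ : TensorAlgebra k N →ₗ[k] R)
    (a b : TensorAlgebra k M →ₗ[k] TensorAlgebra k N) :
    LinearMap.mul' k R ∘ₗ TensorProduct.map φ ψ ∘ₗ ((inl ∘ₗ a) ⋆ (inr ∘ₗ b)) =
      (φ ∘ₗ a) ⋆ (ψ ∘ₗ b) :=
  word_ext fun l => by simp [conv_apply_word]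

lemma conv_comp_cogen (φ ψ : TensorAlgebra k N →ₗ[k] R) {f : TensorAlgebra k M →ₗ[k] N}
    (hf : f 1 = 0) : (φ ⋆ ψ) ∘ₗ cogen f = (φ ∘ₗ cogen f) ⋆ (ψ ∘ₗ cogen f) := by
  rw [← mul_map_inl_conv_inr, ← deconc_cogen hf]; rfl

/-- The coderivation-like operator sending a word to the sum over its subwords `v` of the words
in which `v` is replaced by `b v` and `a` is applied to the letters on the left of `v`. -/
noncomputable def coder (a : M →ₗ[k] M) (b : TensorAlgebra k M →ₗ[k] M) :
    TensorAlgebra k M →ₗ[k] TensorAlgebra k M :=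
  mapT a ⋆ ((TensorAlgebra.ι k ∘ₗ b) ⋆ LinearMap.id)

lemma coder_rec (a : M →ₗ[k] M) (b : TensorAlgebra k M →ₗ[k] M) :
    coder a b = (TensorAlgebra.ι k ∘ₗ b) ⋆ LinearMap.id +
      (TensorAlgebra.ι k ∘ₗ (a ∘ₗ proj)) ⋆ coder a b := by
  have h := mapT_geometric a
  rw [sub_conv, convOne_conv, sub_eq_iff_eq_add] at h
  rw [coder, ← conv_assoc (_ ∘ₗ _)]
  nth_rewrite 1 [h]
  simp

lemma deconc_coder (a : M →ₗ[k] M) (b : TensorAlgebra k M →ₗ[k] M) :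
    deconc ∘ₗ coder a b = (inl ∘ₗ mapT a) ⋆ (inr ∘ₗ coder a b) + (inl ∘ₗ coder a b) ⋆ inr := by
  have h1 : (convOne - inl ∘ₗ (TensorAlgebra.ι k ∘ₗ (a ∘ₗ proj))) ⋆ (deconc ∘ₗ coder a b) =
      inr ∘ₗ coder a b + (inl ∘ₗ (TensorAlgebra.ι k ∘ₗ b)) ⋆ (inl ⋆ inr) := by
    have h := congrArg (deconc ∘ₗ ·) (coder_rec a b)
    have h' := congrArg
      ((inr : TensorAlgebra k M →ₗ[k] TensorAlgebra k M ⊗[k] TensorAlgebra k M) ∘ₗ ·)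
      (coder_rec a b)
    simp only [LinearMap.comp_add] at h h'
    rw [deconc_comp_ι_conv, deconc_comp_ι_conv, LinearMap.comp_id] at h
    rw [one_sub_conv_eq_iff, h', ← deconc_eq]
    refine h.trans ?_
    rw [add_add_add_comm, ← add_assoc]
  have h2 : (inl ∘ₗ mapT a) ⋆ (convOne - inl ∘ₗ (TensorAlgebra.ι k ∘ₗ (a ∘ₗ proj))) =
      (convOne : TensorAlgebra k M →ₗ[k] TensorAlgebra k M ⊗[k] TensorAlgebra k M) := by
    rw [← map_convOne Algebra.TensorProduct.includeLeft, ← LinearMap.comp_sub, ← map_conv,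
      geometric_comm (by simp) (mapT_geometric a)]
  have h3 : inl ∘ₗ coder a b = (inl ∘ₗ mapT a) ⋆ (inl ∘ₗ (TensorAlgebra.ι k ∘ₗ b)) ⋆
      (inl : TensorAlgebra k M →ₗ[k] TensorAlgebra k M ⊗[k] TensorAlgebra k M) := by
    rw [coder, ← conv_assoc, map_conv, map_conv]
    rfl
  calc deconc ∘ₗ coder a b
      = (inl ∘ₗ mapT a) ⋆ ((convOne - inl ∘ₗ (TensorAlgebra.ι k ∘ₗ (a ∘ₗ proj))) ⋆
          (deconc ∘ₗ coder a b)) := by rw [← conv_assoc, h2, convOne_conv]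
    _ = _ := by rw [h1, h3, conv_add, conv_assoc, conv_assoc]

lemma conv_comp_coder (φ ψ : TensorAlgebra k M →ₗ[k] R) (a : M →ₗ[k] M)
    (b : TensorAlgebra k M →ₗ[k] M) :
    (φ ⋆ ψ) ∘ₗ coder a b = (φ ∘ₗ coder a b) ⋆ ψ + (φ ∘ₗ mapT a) ⋆ (ψ ∘ₗ coder a b) := by
  have h1 := mul_map_inl_conv_inr φ ψ (coder a b) LinearMap.id
  have h2 := mul_map_inl_conv_inr φ ψ (mapT a) (coder a b)
  rw [LinearMap.comp_id, LinearMap.comp_id] at h1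
  rw [← h1, ← h2, add_comm, ← LinearMap.comp_add, ← LinearMap.comp_add, ← deconc_coder]
  rfl

end Comultiplicative

end Coalgebra

section Calculus

variable {M N P : Type} [AddCommGroup M] [Module k M] [AddCommGroup N] [Module k N]
  [AddCommGroup P] [Module k P]

lemma coder_one (a : M →ₗ[k] M) {b : TensorAlgebra k M →ₗ[k] M} (hb : b 1 = 0) :
    coder a b 1 = 0 := by
  simp [coder, hb]

lemma counit_coder (a : M →ₗ[k] M) (b : TensorAlgebra k M →ₗ[k] M) :
    counit.toLinearMap ∘ₗ coder a b = 0 :=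
  word_ext fun l => by simp [coder, conv_apply_word]

lemma proj_coder (a : M →ₗ[k] M) (b : TensorAlgebra k M →ₗ[k] M) : proj ∘ₗ coder a b = b :=
  proj_conv_ι_conv (counit_mapT a) (LinearMap.comp_id _) b

lemma convOne_comp_of_counit {X : TensorAlgebra k M →ₗ[k] TensorAlgebra k N} {R : Type} [Ring R]
    [Algebra k R] (h : counit.toLinearMap ∘ₗ X = counit.toLinearMap) :
    (convOne : TensorAlgebra k N →ₗ[k] R) ∘ₗ X = convOne := by
  ext w
  exact congrArg (algebraMap k R) (LinearMap.congr_fun h w)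

lemma cogen_comp_cogen {f : TensorAlgebra k N →ₗ[k] P} {g : TensorAlgebra k M →ₗ[k] N}
    (hf : f 1 = 0) (hg : g 1 = 0) : cogen f ∘ₗ cogen g = cogen (f ∘ₗ cogen g) := by
  refine eq_cogen (by simp [cogen_one hg, hf]) ?_
  have := congrArg (· ∘ₗ cogen g) (cogen_geometric hf)
  rwa [conv_comp_cogen _ _ hg, LinearMap.sub_comp, convOne_comp_of_counit (counit_cogen hg)] at this

lemma coder_add (a : M →ₗ[k] M) (b b' : TensorAlgebra k M →ₗ[k] M) :
    coder a (b + b') = coder a b + coder a b' := by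
  simp [coder, LinearMap.comp_add]

lemma coder_comp_cogen (σ : N →ₗ[k] N) (b : TensorAlgebra k N →ₗ[k] N)
    {f : TensorAlgebra k M →ₗ[k] N} (hf : f 1 = 0) :
    coder σ b ∘ₗ cogen f = (mapT σ ∘ₗ cogen f) ⋆
      ((TensorAlgebra.ι k ∘ₗ (b ∘ₗ cogen f)) ⋆ cogen f) := by
  rw [coder, conv_comp_cogen _ _ hf, conv_comp_cogen _ _ hf]
  rfl

lemma cogen_comp_coder {σ : M →ₗ[k] M} {σ' : N →ₗ[k] N} {b : TensorAlgebra k M →ₗ[k] M}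
    {f : TensorAlgebra k M →ₗ[k] N} (hf : f 1 = 0)
    (hσ : f ∘ₗ mapT σ = σ' ∘ₗ f) :
    cogen f ∘ₗ coder σ b = (mapT σ' ∘ₗ cogen f) ⋆
      ((TensorAlgebra.ι k ∘ₗ (f ∘ₗ coder σ b)) ⋆ cogen f) := by
  have h0 : (convOne : TensorAlgebra k M →ₗ[k] TensorAlgebra k N) ∘ₗ coder σ b = 0 := by
    ext w
    exact (congrArg (algebraMap k _) (LinearMap.congr_fun (counit_coder σ b) w)).trans (map_zero _)
  have h1 := congrArg (· ∘ₗ coder σ b) (cogen_rec hf)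
  simp only [LinearMap.add_comp, h0, zero_add] at h1
  rw [conv_comp_coder, LinearMap.comp_assoc (mapT σ) f, hσ, ← mapT_comp_ι] at h1
  have h2 : (convOne - mapT σ' ∘ₗ (TensorAlgebra.ι k ∘ₗ f)) ⋆ (cogen f ∘ₗ coder σ b) =
      (TensorAlgebra.ι k ∘ₗ (f ∘ₗ coder σ b)) ⋆ cogen f := one_sub_conv_eq_iff.2 h1
  have h3 : (mapT σ' ∘ₗ cogen f) ⋆ (convOne - mapT σ' ∘ₗ (TensorAlgebra.ι k ∘ₗ f)) = convOne := by
    have := congrArg (mapT σ' ∘ₗ ·) (cogen_geometric' hf)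
    simp only [mapT_conv, LinearMap.comp_sub] at this
    rwa [show mapT σ' ∘ₗ (convOne : TensorAlgebra k M →ₗ[k] TensorAlgebra k N) = convOne from
      map_convOne (TensorAlgebra.lift k (TensorAlgebra.ι k ∘ₗ σ'))] at this
  rw [← h2, ← conv_assoc, h3, convOne_conv]

/-- The failure of `cogen f` to commute with the codifferentials is generated by the failure of
the morphism equation for `f`. -/
lemma cogen_defect {σ : M →ₗ[k] M} {σ' : N →ₗ[k] N} {b : TensorAlgebra k M →ₗ[k] M}
    (b' : TensorAlgebra k N →ₗ[k] N)
    {f : TensorAlgebra k M →ₗ[k] N} (hf : f 1 = 0)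
    (hσ : f ∘ₗ mapT σ = σ' ∘ₗ f) :
    cogen f ∘ₗ coder σ b - coder σ' b' ∘ₗ cogen f = (mapT σ' ∘ₗ cogen f) ⋆
      ((TensorAlgebra.ι k ∘ₗ (f ∘ₗ coder σ b - b' ∘ₗ cogen f)) ⋆ cogen f) := by
  rw [cogen_comp_coder hf hσ, coder_comp_cogen _ _ hf, LinearMap.comp_sub, sub_conv, conv_sub]

lemma coder_comp_coder {σ : M →ₗ[k] M} {b : TensorAlgebra k M →ₗ[k] M}
    (hσ : b ∘ₗ mapT σ = -(σ ∘ₗ b)) (h : b ∘ₗ coder σ b = 0) : coder σ b ∘ₗ coder σ b = 0 := by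
  change (mapT σ ⋆ ((TensorAlgebra.ι k ∘ₗ b) ⋆ LinearMap.id)) ∘ₗ coder σ b = 0
  rw [conv_comp_coder, conv_comp_coder, LinearMap.comp_assoc (coder σ b) b, h,
    LinearMap.comp_assoc (mapT σ) b, hσ, LinearMap.comp_neg, ← mapT_comp_ι, LinearMap.comp_zero,
    zero_conv, zero_add, LinearMap.id_comp]
  simp only [coder, mapT_conv, LinearMap.comp_id, neg_conv, conv_neg, conv_assoc]
  exact add_neg_cancel _

lemma coder_linear_cons (a g : M →ₗ[k] M) (x : M) (w : TensorAlgebra k M) :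
    coder a (g ∘ₗ proj) (TensorAlgebra.ι k x * w) =
      TensorAlgebra.ι k (g x) * w + TensorAlgebra.ι k (a x) * coder a (g ∘ₗ proj) w := by
  conv_lhs => rw [coder_rec]
  rw [LinearMap.add_apply, letter_conv_apply_cons, letter_conv_apply_cons, LinearMap.id_apply]

/-- The tensor trick: a contraction of complexes extends to tensor words. -/
lemma coder_homotopy {σ d h q : M →ₗ[k] M} (hq : d ∘ₗ h + h ∘ₗ d = LinearMap.id - q)
    (dq : d ∘ₗ q = 0) (qd : q ∘ₗ d = 0) (σσ : σ ∘ₗ σ = LinearMap.id) (qσ : q ∘ₗ σ = σ ∘ₗ q)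
    (dσ : d ∘ₗ σ = -(σ ∘ₗ d)) (hσ : h ∘ₗ σ = -(σ ∘ₗ h)) :
    coder σ (d ∘ₗ proj) ∘ₗ coder (σ ∘ₗ q) (h ∘ₗ proj) +
      coder (σ ∘ₗ q) (h ∘ₗ proj) ∘ₗ coder σ (d ∘ₗ proj) = LinearMap.id - mapT q := by
  have hq' := fun x => LinearMap.congr_fun hq x
  have dq' := fun x => LinearMap.congr_fun dq x
  have qd' := fun x => LinearMap.congr_fun qd x
  have σσ' := fun x => LinearMap.congr_fun σσ x
  have qσ' := fun x => LinearMap.congr_fun qσ x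
  have dσ' := fun x => LinearMap.congr_fun dσ x
  have hσ' := fun x => LinearMap.congr_fun hσ x
  simp only [LinearMap.comp_apply, LinearMap.add_apply, LinearMap.sub_apply, LinearMap.neg_apply,
    LinearMap.zero_apply, LinearMap.id_apply] at *
  refine tensor_ext (by simp [coder_one]) fun x w ih => ?_
  simp only [LinearMap.comp_apply, LinearMap.add_apply, LinearMap.sub_apply,
    LinearMap.id_apply] at *
  simp only [coder_linear_cons, map_add, LinearMap.comp_apply, mapT_cons, dσ', hσ', qσ', σσ', qd',
    dq', map_zero, map_neg, zero_mul, neg_mul]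
  have h1 : TensorAlgebra.ι k x = TensorAlgebra.ι k (d (h x)) + TensorAlgebra.ι k (h (d x)) +
      TensorAlgebra.ι k (q x) := by
    rw [← map_add, ← map_add, hq', sub_add_cancel]
  rw [h1]
  have h2 := congrArg (TensorAlgebra.ι k (q x) * ·) ih
  simp only [mul_add, mul_sub] at h2
  rw [← sub_eq_zero] at h2 ⊢
  rw [← h2]
  noncomm_ring

lemma coder_linear_comp_mapT {σ d : M →ₗ[k] M} {i : N →ₗ[k] M} (h : d ∘ₗ i = 0) :
    coder σ (d ∘ₗ proj) ∘ₗ mapT i = 0 := by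
  have h' := fun x => LinearMap.congr_fun h x
  simp only [LinearMap.comp_apply, LinearMap.zero_apply] at h'
  refine tensor_ext (by simp [coder_one]) fun x w ih => ?_
  simp only [LinearMap.comp_apply, LinearMap.zero_apply] at ih
  simp [coder_linear_cons, h', ih]

end Calculus

section Graded

variable {M N P : Type} [AddCommGroup M] [Module k M] [AddCommGroup N] [Module k N]
  [AddCommGroup P] [Module k P]

/-- A word of homogeneous letters, of the given total degree. -/
inductive HomWord (g : ℤ → Submodule k M) : List M → ℤ → Prop
  | nil : HomWord g [] 0
  | cons {x : M} {l : List M} {p q : ℤ} : x ∈ g p → HomWord g l q → HomWord g (x :: l) (p + q)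

/-- `f` raises the degree of homogeneous words by `c`. -/
def IsHom (g : ℤ → Submodule k M) (g' : ℤ → Submodule k N) (c : ℤ)
    (f : TensorAlgebra k M →ₗ[k] N) : Prop :=
  ∀ l q, HomWord g l q → f (word l) ∈ g' (q + c)

/-- The grading of the space of tensor words. -/
def tgr (g : ℤ → Submodule k M) (q : ℤ) : Submodule k (TensorAlgebra k M) :=
  Submodule.span k {w | ∃ l, HomWord g l q ∧ w = word l}

variable {g : ℤ → Submodule k M} {g' : ℤ → Submodule k N} {g'' : ℤ → Submodule k P} {c c' : ℤ}

lemma HomWord.append {l l' : List M} {p q : ℤ} (h : HomWord g l p) (h' : HomWord g l' q) :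
    HomWord g (l ++ l') (p + q) := by
  induction h with
  | nil => simpa using h'
  | cons hx _ ih => rw [add_assoc]; exact .cons hx ih

lemma HomWord.split {l : List M} {q : ℤ} (h : HomWord g l q) (i : ℕ) :
    ∃ p r, HomWord g (l.take i) p ∧ HomWord g (l.drop i) r ∧ q = p + r := by
  induction h generalizing i with
  | nil => exact ⟨0, 0, by simpa using .nil, by simpa using .nil, by simp⟩
  | @cons x l p q hx hl ih =>
    cases i with
    | zero => exact ⟨0, p + q, .nil, .cons hx hl, by simp⟩
    | succ i =>
      obtain ⟨p', r, h1, h2, rfl⟩ := ih i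
      exact ⟨p + p', r, .cons hx h1, h2, by ring⟩

lemma HomWord.word_mem {l : List M} {q : ℤ} (h : HomWord g l q) : word l ∈ tgr g q :=
  Submodule.subset_span ⟨l, h, rfl⟩

lemma HomWord.mapT_sign {σ : M →ₗ[k] M} (hσ : ∀ p, ∀ x ∈ g p, σ x = (-1 : k) ^ p • x)
    {l : List M} {q : ℤ} (h : HomWord g l q) : mapT σ (word l) = (-1 : k) ^ q • word l := by
  induction h with
  | nil => simp
  | cons hx _ ih => simp [ih, hσ _ _ hx, zpow_add₀, smul_smul, mul_comm]

lemma one_mem_tgr : (1 : TensorAlgebra k M) ∈ tgr g 0 := HomWord.nil.word_mem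

lemma ι_mem_tgr {x : M} {p : ℤ} (hx : x ∈ g p) : TensorAlgebra.ι k x ∈ tgr g p := by
  simpa using (HomWord.cons hx .nil).word_mem

lemma mul_mem_tgr {v w : TensorAlgebra k M} {p q : ℤ} (hv : v ∈ tgr g p) (hw : w ∈ tgr g q) :
    v * w ∈ tgr g (p + q) := by
  have := Submodule.mul_mem_mul hv hw
  rw [tgr, tgr, Submodule.span_mul_span] at this
  refine Submodule.span_mono ?_ this
  rintro _ ⟨_, ⟨l, hl, rfl⟩, _, ⟨l', hl', rfl⟩, rfl⟩
  exact ⟨l ++ l', hl.append hl', (word_append l l').symm⟩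

namespace IsHom

lemma apply_mem {f : TensorAlgebra k M →ₗ[k] N} (hf : IsHom g g' c f) {w : TensorAlgebra k M}
    {q : ℤ} (hw : w ∈ tgr g q) : f w ∈ g' (q + c) := by
  have : tgr g q ≤ (g' (q + c)).comap f := by
    refine Submodule.span_le.2 ?_
    rintro _ ⟨l, hl, rfl⟩
    exact hf l q hl
  exact this hw

lemma comp {f : TensorAlgebra k N →ₗ[k] P} {X : TensorAlgebra k M →ₗ[k] TensorAlgebra k N}
    (hf : IsHom g' g'' c' f) (hX : IsHom g (tgr g') c X) : IsHom g g'' (c + c') (f ∘ₗ X) := by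
  intro l q hl
  rw [← add_assoc]
  exact hf.apply_mem (hX l q hl)

lemma linear_comp {f : TensorAlgebra k M →ₗ[k] N} {a : N →ₗ[k] P} (hf : IsHom g g' c f)
    (ha : ∀ p, ∀ x ∈ g' p, a x ∈ g'' (p + c')) : IsHom g g'' (c + c') (a ∘ₗ f) := by
  intro l q hl
  rw [← add_assoc]
  exact ha _ _ (hf l q hl)

lemma add {f f' : TensorAlgebra k M →ₗ[k] N} (hf : IsHom g g' c f) (hf' : IsHom g g' c f') :
    IsHom g g' c (f + f') := fun l q hl => add_mem (hf l q hl) (hf' l q hl)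

lemma sub {f f' : TensorAlgebra k M →ₗ[k] N} (hf : IsHom g g' c f) (hf' : IsHom g g' c f') :
    IsHom g g' c (f - f') := fun l q hl => sub_mem (hf l q hl) (hf' l q hl)

lemma ι_comp {f : TensorAlgebra k M →ₗ[k] N} (hf : IsHom g g' c f) :
    IsHom g (tgr g') c (TensorAlgebra.ι k ∘ₗ f) := fun l q hl => ι_mem_tgr (hf l q hl)

lemma conv {X Y : TensorAlgebra k M →ₗ[k] TensorAlgebra k N} (hX : IsHom g (tgr g') c X)
    (hY : IsHom g (tgr g') c' Y) : IsHom g (tgr g') (c + c') (X ⋆ Y) := by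
  intro l q hl
  rw [conv_apply_word]
  refine Submodule.sum_mem _ fun i _ => ?_
  obtain ⟨p, r, h1, h2, rfl⟩ := hl.split i
  rw [add_add_add_comm]
  exact mul_mem_tgr (hX _ _ h1) (hY _ _ h2)

lemma id : IsHom g (tgr g) 0 LinearMap.id := fun l q hl => by simpa using hl.word_mem

lemma of_linear {a : M →ₗ[k] N} (ha : ∀ p, ∀ x ∈ g p, a x ∈ g' (p + c)) :
    IsHom g g' c (a ∘ₗ proj) := by
  rintro _ _ (_ | ⟨hx, hl⟩)
  · simp
  · rename_i x l p q
    cases hl with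
    | nil => simpa using ha p x hx
    | cons => simp [proj_cons]

lemma cogen {f : TensorAlgebra k M →ₗ[k] N} (hf1 : f 1 = 0) (hf : IsHom g g' 0 f) :
    IsHom g (tgr g') 0 (cogen f) := by
  suffices ∀ n, ∀ l : List M, l.length < n → ∀ q, HomWord g l q →
      Stmt13.cogen f (word l) ∈ tgr g' (q + 0) from
    fun l q hl => this (l.length + 1) l (Nat.lt_succ_self _) q hl
  intro n
  induction n with
  | zero => intro l hl; omega
  | succ n ih =>
    intro l hln q hl
    cases hl with
    | nil => simpa [cogen_one hf1] using one_mem_tgr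
    | cons hx hl =>
      rename_i x l p q
      rw [cogen_rec hf1, LinearMap.add_apply, word_cons, convOne_cons, zero_add, ← word_cons,
        conv_apply_word]
      refine Submodule.sum_mem _ fun i _ => ?_
      obtain ⟨p', r, h1, h2, h⟩ := (HomWord.cons hx hl).split i
      cases i with
      | zero => simp [hf1]
      | succ i =>
        rw [h, add_zero, ← add_zero p', ← add_zero r]
        exact mul_mem_tgr (ι_mem_tgr (hf _ _ h1))
          (ih _ (by simp only [List.length_cons] at hln; simp; omega) _ h2)

lemma mapT {a : M →ₗ[k] N} (ha : ∀ p, ∀ x ∈ g p, a x ∈ g' p) : IsHom g (tgr g') 0 (mapT a) := by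
  rw [mapT_eq_cogen]
  exact cogen (by simp) (of_linear fun p x hx => by simpa using ha p x hx)

lemma coder {a : M →ₗ[k] M} {b : TensorAlgebra k M →ₗ[k] M} (ha : ∀ p, ∀ x ∈ g p, a x ∈ g p)
    (hb : IsHom g g c b) : IsHom g (tgr g) c (coder a b) := by
  have := (mapT ha).conv (hb.ι_comp.conv id)
  rwa [zero_add, add_zero] at this

/-- Homogeneous maps commute with the grading signs up to sign. -/
lemma apply_mapT_sign {σ : M →ₗ[k] M} {σ' : N →ₗ[k] N}
    (hσ : ∀ p, ∀ x ∈ g p, σ x = (-1 : k) ^ p • x) (hσ' : ∀ p, ∀ x ∈ g' p, σ' x = (-1 : k) ^ p • x)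
    {f : TensorAlgebra k M →ₗ[k] N} (hf : IsHom g g' c f) {l : List M} {q : ℤ}
    (hl : HomWord g l q) : f (Stmt13.mapT σ (word l)) = (-1 : k) ^ c • σ' (f (word l)) := by
  rw [hl.mapT_sign hσ, map_smul, hσ' _ _ (hf l q hl), smul_smul, zpow_add₀ (by simp), mul_left_comm,
    ← mul_zpow]
  simp

end IsHom

lemma homWord_ext (hg : ⨆ p, g p = ⊤) {φ ψ : TensorAlgebra k M →ₗ[k] N}
    (h : ∀ l q, HomWord g l q → φ (word l) = ψ (word l)) : φ = ψ := by
  suffices ∀ l : List M, ∀ φ : TensorAlgebra k M →ₗ[k] N,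
      (∀ l q, HomWord g l q → φ (word l) = 0) → φ (word l) = 0 by
    refine word_ext fun l => ?_
    have := this l (φ - ψ) fun l q hl => by simp [h l q hl]
    simpa [sub_eq_zero] using this
  intro l
  induction l with
  | nil => exact fun φ hφ => hφ [] 0 .nil
  | cons x l ih =>
    intro φ hφ
    have hx : x ∈ ⨆ p, g p := hg ▸ Submodule.mem_top
    rw [word_cons]
    induction hx using Submodule.iSup_induction' with
    | mem p x hx =>
      exact ih (φ ∘ₗ LinearMap.mulLeft k (TensorAlgebra.ι k x)) fun l q hl => by
        simpa using hφ _ _ (HomWord.cons hx hl)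
    | zero => simp
    | add x y _ _ hx hy => rw [map_add, add_mul, map_add, hx, hy, add_zero]

lemma IsHom.comp_mapT_even (hg : ⨆ p, g p = ⊤) {σ : M →ₗ[k] M} {σ' : N →ₗ[k] N}
    (hσ : ∀ p, ∀ x ∈ g p, σ x = (-1 : k) ^ p • x) (hσ' : ∀ p, ∀ x ∈ g' p, σ' x = (-1 : k) ^ p • x)
    {f : TensorAlgebra k M →ₗ[k] N} (hf : IsHom g g' 0 f) : f ∘ₗ Stmt13.mapT σ = σ' ∘ₗ f :=
  homWord_ext hg fun l q hl => by simpa using hf.apply_mapT_sign hσ hσ' hl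

lemma IsHom.comp_mapT_odd (hg : ⨆ p, g p = ⊤) {σ : M →ₗ[k] M} {σ' : N →ₗ[k] N}
    (hσ : ∀ p, ∀ x ∈ g p, σ x = (-1 : k) ^ p • x) (hσ' : ∀ p, ∀ x ∈ g' p, σ' x = (-1 : k) ^ p • x)
    {f : TensorAlgebra k M →ₗ[k] N} (hf : IsHom g g' 1 f) : f ∘ₗ Stmt13.mapT σ = -(σ' ∘ₗ f) :=
  homWord_ext hg fun l q hl => by simpa using hf.apply_mapT_sign hσ hσ' hl

/-- The filtration by length, presented as a grading. -/
def lenGr (M : Type) [AddCommGroup M] [Module k M] (p : ℤ) : Submodule k M :=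
  if 1 ≤ p then ⊤ else ⊥

lemma homWord_lenGr (l : List M) : HomWord (lenGr (k := k) M) l l.length := by
  induction l with
  | nil => exact .nil
  | cons x l ih =>
    have := HomWord.cons (g := lenGr (k := k) M) (x := x) (p := 1) (by simp [lenGr]) ih
    simpa [add_comm] using this

lemma HomWord.length_le {l : List M} {q : ℤ} (h : HomWord (lenGr (k := k) M) l q) :
    word (k := k) l = 0 ∨ (l.length : ℤ) ≤ q := by
  induction h with
  | nil => simp
  | @cons x l p q hx _ ih =>
    by_cases hp : 1 ≤ p
    · rcases ih with h | h
      · simp [h]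
      · right; simp; omega
    · have : x = 0 := by simpa [lenGr, hp] using hx
      simp [this]

lemma isHom_lenGr_iff {f : TensorAlgebra k M →ₗ[k] N} :
    IsHom (lenGr M) (lenGr N) c f ↔ ∀ l : List M, l.length + c ≤ 0 → f (word l) = 0 := by
  constructor
  · intro h l hl
    have := h l _ (homWord_lenGr l)
    rwa [lenGr, if_neg (by omega), Submodule.mem_bot] at this
  · intro h l q hl
    rcases hl.length_le with h0 | h0
    · simp [h0]
    · by_cases hq : 1 ≤ q + c
      · simp [lenGr, hq]
      · rw [h l (by omega)]; exact zero_mem _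

lemma vanishesBelow_iff_isHom {f : TensorAlgebra k M →ₗ[k] N} {n : ℕ} :
    VanishesBelow n f ↔ IsHom (lenGr M) (lenGr N) (1 - n) f := by
  rw [isHom_lenGr_iff]
  exact ⟨fun h l hl => h l (by omega), fun h l hl => h l (by omega)⟩

lemma isHom_lenGr_zero {f : TensorAlgebra k M →ₗ[k] N} (hf : f 1 = 0) :
    IsHom (lenGr M) (lenGr N) 0 f := by
  rw [isHom_lenGr_iff]
  intro l hl
  have : l = [] := List.length_eq_zero_iff.1 (by omega)
  simpa [this] using hf

end Graded

section Filtration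

variable {M N P : Type} [AddCommGroup M] [Module k M] [AddCommGroup N] [Module k N]
  [AddCommGroup P] [Module k P]

/-- `X` takes words of length `n` to combinations of words of length at most `n - m`. -/
def Shortens (m : ℕ) (X : TensorAlgebra k M →ₗ[k] TensorAlgebra k N) : Prop :=
  IsHom (lenGr M) (tgr (lenGr N)) (-m) X

lemma VanishesBelow.isHom {f : TensorAlgebra k M →ₗ[k] N} {m : ℕ} (h : VanishesBelow (m + 1) f) :
    IsHom (lenGr M) (lenGr N) (-m) f := by
  have := vanishesBelow_iff_isHom.1 h
  rwa [show (1 : ℤ) - (m + 1 : ℕ) = -m by push_cast; ring] at this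

lemma VanishesBelow.comp {φ : TensorAlgebra k N →ₗ[k] P} {n m : ℕ} (h : VanishesBelow n φ)
    {X : TensorAlgebra k M →ₗ[k] TensorAlgebra k N} (hX : Shortens m X) :
    VanishesBelow (n + m) (φ ∘ₗ X) := by
  rw [vanishesBelow_iff_isHom] at h ⊢
  have := h.comp hX
  rwa [show -(m : ℤ) + (1 - n) = 1 - (n + m : ℕ) by push_cast; ring] at this

lemma VanishesBelow.linear_comp {φ : TensorAlgebra k M →ₗ[k] N} {n : ℕ} (h : VanishesBelow n φ)
    (a : N →ₗ[k] P) : VanishesBelow n (a ∘ₗ φ) := fun l hl => by simp [h l hl]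

lemma vanishesBelow_one_iff {f : TensorAlgebra k M →ₗ[k] N} : VanishesBelow 1 f ↔ f 1 = 0 := by
  refine ⟨fun h => h [] (by simp), fun h l hl => ?_⟩
  have : l = [] := List.length_eq_zero_iff.1 (by omega)
  simpa [this] using h

lemma shortens_mapT (a : M →ₗ[k] N) : Shortens 0 (mapT a) := by
  have : IsHom (lenGr M) (tgr (lenGr N)) 0 (mapT a) := IsHom.mapT fun p x hx => by
    by_cases hp : 1 ≤ p
    · simp [lenGr, hp]
    · have : x = 0 := by simpa [lenGr, hp] using hx
      simp [this]
  simpa [Shortens] using this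

lemma shortens_cogen {f : TensorAlgebra k M →ₗ[k] N} (hf : f 1 = 0) : Shortens 0 (cogen f) := by
  simpa [Shortens] using IsHom.cogen hf (isHom_lenGr_zero hf)

lemma shortens_coder (a : M →ₗ[k] M) {b : TensorAlgebra k M →ₗ[k] M} {m : ℕ}
    (hb : VanishesBelow (m + 1) b) : Shortens m (coder a b) := by
  have := (shortens_mapT a).conv (hb.isHom.ι_comp.conv IsHom.id)
  simpa [Shortens, coder] using this

lemma shortens_coder_sub (a : M →ₗ[k] M) {b b' : TensorAlgebra k M →ₗ[k] M} {m : ℕ}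
    (h : VanishesBelow (m + 1) (b - b')) : Shortens m (coder a b - coder a b') := by
  have : coder a b - coder a b' = coder a (b - b') := by
    rw [sub_eq_iff_eq_add, ← coder_add, sub_add_cancel]
  rw [this]
  exact shortens_coder a h

lemma shortens_cogen_sub {f f' : TensorAlgebra k M →ₗ[k] N} (hf : f 1 = 0) (hf' : f' 1 = 0)
    {m : ℕ} (h : VanishesBelow (m + 1) (f - f')) : Shortens m (cogen f - cogen f') := by
  rw [cogen_sub hf hf']
  have := (shortens_cogen hf').conv (h.isHom.ι_comp.conv (shortens_cogen hf))
  simpa [Shortens] using this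

lemma shortens_defect {σ : M →ₗ[k] M} {σ' : N →ₗ[k] N} {b : TensorAlgebra k M →ₗ[k] M}
    {b' : TensorAlgebra k N →ₗ[k] N} {f : TensorAlgebra k M →ₗ[k] N} (hf : f 1 = 0)
    (hσ : f ∘ₗ mapT σ = σ' ∘ₗ f) {m : ℕ}
    (h : VanishesBelow (m + 1) (f ∘ₗ coder σ b - b' ∘ₗ cogen f)) :
    Shortens m (cogen f ∘ₗ coder σ b - coder σ' b' ∘ₗ cogen f) := by
  rw [cogen_defect b' hf hσ]
  have h1 : Shortens 0 (mapT σ' ∘ₗ cogen f) := by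
    simpa [Shortens] using IsHom.comp (shortens_mapT σ') (shortens_cogen hf)
  have := h1.conv (h.isHom.ι_comp.conv (shortens_cogen hf))
  simpa [Shortens] using this

lemma exists_graded_limit {g : ℤ → Submodule k M} {g' : ℤ → Submodule k N} {c : ℤ}
    (s : ℕ → TensorAlgebra k M →ₗ[k] N) (hs : ∀ n, VanishesBelow n (s (n + 1) - s n))
    (hg : ∀ n, IsHom g g' c (s n)) :
    ∃ φ : TensorAlgebra k M →ₗ[k] N, (∀ n, VanishesBelow n (φ - s n)) ∧ IsHom g g' c φ := by
  obtain ⟨φ, h, h'⟩ := exists_limit s hs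
  exact ⟨φ, h, fun l q hl => h' l ▸ hg _ l q hl⟩

end Filtration

section Transfer

variable {M N : Type} [AddCommGroup M] [Module k M] [AddCommGroup N] [Module k N]

/-- A graded vector space together with the operator `(-1)^degree`. -/
structure SignedGrading (g : ℤ → Submodule k M) (σ : M →ₗ[k] M) : Prop where
  iSup_eq : ⨆ p, g p = ⊤
  sign : ∀ p, ∀ x ∈ g p, σ x = (-1 : k) ^ p • x

lemma SignedGrading.comp_eq {g : ℤ → Submodule k M} {g' : ℤ → Submodule k N} {σ : M →ₗ[k] M}
    {σ' : N →ₗ[k] N} (hg : SignedGrading g σ) (hg' : SignedGrading g' σ') {c : ℤ} {a : M →ₗ[k] N}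
    (ha : ∀ p, ∀ x ∈ g p, a x ∈ g' (p + c)) : a ∘ₗ σ = (-1 : k) ^ c • (σ' ∘ₗ a) := by
  ext x
  have hx : x ∈ ⨆ p, g p := hg.iSup_eq ▸ Submodule.mem_top
  induction hx using Submodule.iSup_induction' with
  | mem p x hx =>
    simp only [LinearMap.comp_apply, LinearMap.smul_apply, hg.sign p x hx, map_smul,
      hg'.sign _ _ (ha p x hx), smul_smul]
    rw [zpow_add₀ (by simp), mul_left_comm, ← mul_zpow]
    simp
  | zero => simp
  | add x y _ _ hx hy => rw [map_add, map_add, hx, hy]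

lemma SignedGrading.sign_mem {g : ℤ → Submodule k M} {σ : M →ₗ[k] M} (hg : SignedGrading g σ)
    (p : ℤ) (x : M) (hx : x ∈ g p) : σ x ∈ g p := by
  rw [hg.sign p x hx]; exact Submodule.smul_mem _ _ hx

lemma SignedGrading.sign_sign {g : ℤ → Submodule k M} {σ : M →ₗ[k] M} (hg : SignedGrading g σ) :
    σ ∘ₗ σ = LinearMap.id := by
  ext x
  have hx : x ∈ ⨆ p, g p := hg.iSup_eq ▸ Submodule.mem_top
  induction hx using Submodule.iSup_induction' with
  | mem p x hx =>
    simp only [LinearMap.comp_apply, hg.sign p x hx, map_smul, smul_smul, ← mul_zpow]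
    simp
  | zero => simp
  | add x y _ _ hx hy => rw [map_add, map_add, hx, hy]

/-- An A∞-structure as a codifferential on tensor words, given by its corestriction `b`. -/
structure IsAlg (g : ℤ → Submodule k M) (σ : M →ₗ[k] M) (b : TensorAlgebra k M →ₗ[k] M) :
    Prop where
  map_one : b 1 = 0
  isHom : IsHom g g 1 b
  rel : b ∘ₗ coder σ b = 0

/-- An A∞-morphism as a map of tensor coalgebras, given by its corestriction `f`. -/
structure IsMor (g : ℤ → Submodule k M) (σ : M →ₗ[k] M) (b : TensorAlgebra k M →ₗ[k] M)
    (g' : ℤ → Submodule k N) (b' : TensorAlgebra k N →ₗ[k] N)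
    (f : TensorAlgebra k M →ₗ[k] N) : Prop where
  map_one : f 1 = 0
  isHom : IsHom g g' 0 f
  rel : f ∘ₗ coder σ b = b' ∘ₗ cogen f

/-- A contraction of the complex `(M, d)` onto `N` with zero differential. -/
structure IsContraction (g : ℤ → Submodule k M) (g' : ℤ → Submodule k N) (d : M →ₗ[k] M)
    (p : M →ₗ[k] N) (i : N →ₗ[k] M) (h : M →ₗ[k] M) : Prop where
  d_mem : ∀ n, ∀ x ∈ g n, d x ∈ g (n + 1)
  p_mem : ∀ n, ∀ x ∈ g n, p x ∈ g' n
  i_mem : ∀ n, ∀ x ∈ g' n, i x ∈ g n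
  h_mem : ∀ n, ∀ x ∈ g n, h x ∈ g (n + -1)
  pd : p ∘ₗ d = 0
  di : d ∘ₗ i = 0
  pi : p ∘ₗ i = LinearMap.id
  homotopy : d ∘ₗ h + h ∘ₗ d = LinearMap.id - i ∘ₗ p

variable {g : ℤ → Submodule k M} {g' : ℤ → Submodule k N} {d : M →ₗ[k] M}
    {p : M →ₗ[k] N} {i : N →ₗ[k] M} {h : M →ₗ[k] M} {σ : M →ₗ[k] M} {σ' : N →ₗ[k] N}
    {b : TensorAlgebra k M →ₗ[k] M}

lemma IsContraction.tensor_homotopy (hc : IsContraction g g' d p i h) (hg : SignedGrading g σ) :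
    coder σ (d ∘ₗ proj) ∘ₗ coder (σ ∘ₗ (i ∘ₗ p)) (h ∘ₗ proj) +
      coder (σ ∘ₗ (i ∘ₗ p)) (h ∘ₗ proj) ∘ₗ coder σ (d ∘ₗ proj) =
      LinearMap.id - mapT i ∘ₗ mapT p := by
  rw [mapT_comp]
  refine coder_homotopy hc.homotopy ?_ ?_ hg.sign_sign ?_ ?_ ?_
  · rw [← LinearMap.comp_assoc, hc.di, LinearMap.zero_comp]
  · rw [LinearMap.comp_assoc, hc.pd, LinearMap.comp_zero]
  · simpa using hg.comp_eq hg (c := 0) (a := i ∘ₗ p)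
      fun n x hx => by simpa using hc.i_mem _ _ (hc.p_mem _ _ hx)
  · simpa using hg.comp_eq hg hc.d_mem
  · simpa using hg.comp_eq hg hc.h_mem

lemma IsAlg.coder_coder (hb : IsAlg g σ b) (hg : SignedGrading g σ) :
    coder σ b ∘ₗ coder σ b = 0 :=
  coder_comp_coder (hb.isHom.comp_mapT_odd hg.iSup_eq hg.sign hg.sign) hb.rel

/-- An approximation, up to length `r`, to a minimal model of `(M, b)` and the projection to it. -/
structure IsPartialModel (g : ℤ → Submodule k M) (g' : ℤ → Submodule k N) (σ : M →ₗ[k] M)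
    (σ' : N →ₗ[k] N) (b : TensorAlgebra k M →ₗ[k] M) (p : M →ₗ[k] N) (r : ℕ)
    (f : TensorAlgebra k M →ₗ[k] N) (b' : TensorAlgebra k N →ₗ[k] N) : Prop where
  map_one : f 1 = 0
  f_isHom : IsHom g g' 0 f
  f_sub : VanishesBelow 2 (f - p ∘ₗ proj)
  b_isHom : IsHom g' g' 1 b'
  b_min : VanishesBelow 2 b'
  mor : VanishesBelow (r + 1) (f ∘ₗ coder σ b - b' ∘ₗ cogen f)
  alg : VanishesBelow (r + 1) (b' ∘ₗ coder σ' b')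

lemma IsPartialModel.step (hg : SignedGrading g σ) (hg' : SignedGrading g' σ')
    (hb : IsAlg g σ b) (hbd : VanishesBelow 2 (b - d ∘ₗ proj)) (hc : IsContraction g g' d p i h)
    {r : ℕ} (hr : 1 ≤ r) {f : TensorAlgebra k M →ₗ[k] N} {b' : TensorAlgebra k N →ₗ[k] N}
    (hm : IsPartialModel g g' σ σ' b p r f b') :
    ∃ f₂ b₂, IsPartialModel g g' σ σ' b p (r + 1) f₂ b₂ ∧ VanishesBelow (r + 1) (f₂ - f) ∧
      VanishesBelow (r + 1) (b₂ - b') := by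
  set e := f ∘ₗ coder σ b - b' ∘ₗ cogen f with he
  set H := coder (σ ∘ₗ (i ∘ₗ p)) (h ∘ₗ proj) with hH
  set D := coder σ b with hD
  set d' := coder σ (d ∘ₗ proj) with hd'
  set D' := coder σ' b' with hD'
  have hHs : Shortens 0 H := shortens_coder _ (vanishesBelow_one_iff.2 (by simp))
  have hqm : ∀ n, ∀ x ∈ g n, (σ ∘ₗ (i ∘ₗ p)) x ∈ g n :=
    fun n x hx => hg.sign_mem _ _ (hc.i_mem _ _ (hc.p_mem _ _ hx))
  have hHd : IsHom g (tgr g) (-1) H := IsHom.coder hqm (IsHom.of_linear hc.h_mem)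
  have hDd : IsHom g (tgr g) 1 D := IsHom.coder hg.sign_mem hb.isHom
  have hed : IsHom g g' 1 e := by
    have h1 := hm.f_isHom.comp hDd
    have h2 := hm.b_isHom.comp (IsHom.cogen hm.map_one hm.f_isHom)
    simp only [zero_add, add_zero] at h1 h2
    exact h1.sub h2
  have heH : VanishesBelow (r + 1) (e ∘ₗ H) := hm.mor.comp hHs
  have hei : VanishesBelow (r + 1) (e ∘ₗ mapT i) := hm.mor.comp (shortens_mapT i)
  set f₂ := f - e ∘ₗ H with hf₂
  set b₂ := b' + e ∘ₗ mapT i with hb₂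
  have hff : VanishesBelow (r + 1) (f₂ - f) := by
    rw [hf₂, sub_sub_cancel_left]; exact heH.neg
  have hbb : VanishesBelow (r + 1) (b₂ - b') := by
    rw [hb₂, add_sub_cancel_left]; exact hei
  have hf₂1 : f₂ 1 = 0 := by
    have := hff [] (by simp)
    simpa [hm.map_one] using this
  have hf₂s : VanishesBelow 2 (f₂ - p ∘ₗ proj) := by
    have := (hff.mono (show 2 ≤ r + 1 by omega)).add hm.f_sub
    rwa [sub_add_sub_cancel] at this
  have hb₂m : VanishesBelow 2 b₂ := hm.b_min.add (hei.mono (by omega))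
  -- the obstruction composed with the linear differential vanishes to higher order
  have hFp : ∀ {φ : TensorAlgebra k M →ₗ[k] N}, φ 1 = 0 → VanishesBelow 2 (φ - p ∘ₗ proj) →
      Shortens 1 (cogen φ - mapT p) := by
    intro φ h1 h2
    rw [mapT_eq_cogen]
    exact shortens_cogen_sub h1 (by simp) h2
  have hDd' : Shortens 1 (D - d') := shortens_coder_sub _ hbd
  have hσf : f ∘ₗ mapT σ = σ' ∘ₗ f := hm.f_isHom.comp_mapT_even hg.iSup_eq hg.sign hg'.sign
  have hpi : mapT p ∘ₗ mapT i = LinearMap.id := by rw [mapT_comp, hc.pi, mapT_id]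
  have hedc : VanishesBelow (r + 2) (e ∘ₗ d' + (b' ∘ₗ D') ∘ₗ mapT p) := by
    have h1 : e ∘ₗ D = -(b' ∘ₗ (cogen f ∘ₗ D - D' ∘ₗ cogen f)) - (b' ∘ₗ D') ∘ₗ cogen f := by
      rw [he, LinearMap.sub_comp, LinearMap.comp_assoc, hb.coder_coder hg, LinearMap.comp_sub]
      simp only [LinearMap.comp_assoc, LinearMap.comp_zero]
      abel
    have h2 : e ∘ₗ d' + (b' ∘ₗ D') ∘ₗ mapT p =
        -(e ∘ₗ (D - d')) - b' ∘ₗ (cogen f ∘ₗ D - D' ∘ₗ cogen f) -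
          (b' ∘ₗ D') ∘ₗ (cogen f - mapT p) := by
      rw [LinearMap.comp_sub _ _ e, h1, LinearMap.comp_sub _ _ (b' ∘ₗ D')]
      abel
    rw [h2]
    have h3 := hm.b_min.comp (shortens_defect hm.map_one hσf hm.mor)
    exact ((hm.mor.comp hDd').neg.sub (h3.mono (by omega))).sub
      (hm.alg.comp (hFp hm.map_one hm.f_sub))
  have hc0 : VanishesBelow (r + 2) (b' ∘ₗ D') := by
    have := hedc.comp (shortens_mapT i)
    rwa [LinearMap.add_comp, LinearMap.comp_assoc, LinearMap.comp_assoc, hpi,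
      coder_linear_comp_mapT hc.di, LinearMap.comp_zero, zero_add, LinearMap.comp_id] at this
  have hed0 : VanishesBelow (r + 2) (e ∘ₗ d') := by
    have := hedc.sub (hc0.comp (shortens_mapT p))
    rwa [add_sub_cancel_right] at this
  refine ⟨f₂, b₂, ⟨hf₂1, ?_, hf₂s, ?_, hb₂m, ?_, ?_⟩, hff, hbb⟩
  · exact hm.f_isHom.sub (by simpa using hed.comp hHd)
  · exact hm.b_isHom.add (by simpa using hed.comp (IsHom.mapT hc.i_mem))
  · have h1 : f₂ ∘ₗ D - b₂ ∘ₗ cogen f₂ = (e ∘ₗ d') ∘ₗ H - (e ∘ₗ H) ∘ₗ (D - d') -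
        b' ∘ₗ (cogen f₂ - cogen f) - (e ∘ₗ mapT i) ∘ₗ (cogen f₂ - mapT p) := by
      have h2 := congrArg (e ∘ₗ ·) (hc.tensor_homotopy hg)
      simp only [LinearMap.comp_add, LinearMap.comp_sub, LinearMap.comp_id] at h2
      rw [← hd', ← hH, ← eq_sub_iff_add_eq] at h2
      have h3 : f₂ ∘ₗ D = f ∘ₗ D - e ∘ₗ (H ∘ₗ D) := by
        rw [hf₂, LinearMap.sub_comp, LinearMap.comp_assoc]
      rw [LinearMap.comp_assoc H d' e, h2, h3, hb₂]
      simp only [LinearMap.comp_sub, LinearMap.add_comp, LinearMap.comp_assoc]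
      nth_rewrite 3 [he]
      abel
    rw [h1]
    have h3 := hm.b_min.comp (shortens_cogen_sub hf₂1 hm.map_one hff)
    exact (((hed0.comp hHs).sub (heH.comp hDd')).sub (h3.mono (by omega))).sub
      (hei.comp (hFp hf₂1 hf₂s))
  · have h1 : b₂ ∘ₗ coder σ' b₂ = b' ∘ₗ D' + b' ∘ₗ (coder σ' b₂ - D') +
        (e ∘ₗ mapT i) ∘ₗ coder σ' b₂ := by
      rw [LinearMap.comp_sub, add_sub_cancel, hb₂, ← hb₂, LinearMap.add_comp]
    rw [h1]
    exact (hc0.add ((hm.b_min.comp (shortens_coder_sub _ hbb)).mono (by omega))).add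
      (hei.comp (shortens_coder _ hb₂m))

end Transfer

lemma exists_sequence {α : Type} {P : ℕ → α → Prop} {R : ℕ → α → α → Prop} {x : α} (hx : P 0 x)
    (step : ∀ n x, P n x → ∃ y, P (n + 1) y ∧ R n x y) :
    ∃ s : ℕ → α, (∀ n, P n (s n)) ∧ ∀ n, R n (s n) (s (n + 1)) := by
  choose next h₁ h₂ using step
  let s : ∀ n, {x // P n x} :=
    fun n => Nat.rec ⟨x, hx⟩ (fun n y => ⟨next n y.1 y.2, h₁ n y.1 y.2⟩) n
  exact ⟨fun n => (s n).1, fun n => (s n).2, fun n => h₂ n (s n).1 (s n).2⟩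

section Models

variable {M N : Type} [AddCommGroup M] [Module k M] [AddCommGroup N] [Module k N]
  {g : ℤ → Submodule k M} {g' : ℤ → Submodule k N} {d : M →ₗ[k] M}
  {p : M →ₗ[k] N} {i : N →ₗ[k] M} {h : M →ₗ[k] M} {σ : M →ₗ[k] M} {σ' : N →ₗ[k] N}
  {b : TensorAlgebra k M →ₗ[k] M}

theorem exists_minimal_model (hg : SignedGrading g σ) (hg' : SignedGrading g' σ')
    (hb : IsAlg g σ b) (hbd : VanishesBelow 2 (b - d ∘ₗ proj)) (hc : IsContraction g g' d p i h) :
    ∃ f b', IsMor g σ b g' b' f ∧ IsAlg g' σ' b' ∧ VanishesBelow 2 b' ∧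
      VanishesBelow 2 (f - p ∘ₗ proj) := by
  have hbase : IsPartialModel g g' σ σ' b p 1 (p ∘ₗ proj) 0 := by
    refine ⟨by simp, IsHom.of_linear (c := 0) (by simpa using hc.p_mem), fun l _ => by simp,
      fun l q _ => by simp, fun l _ => by simp, ?_, fun l _ => by simp⟩
    have h1 := hbd.linear_comp p
    rwa [LinearMap.comp_sub, ← LinearMap.comp_assoc, hc.pd, LinearMap.zero_comp, sub_zero,
      ← proj_coder σ b, ← LinearMap.comp_assoc, ← sub_zero ((p ∘ₗ proj) ∘ₗ coder σ b),
      ← LinearMap.zero_comp (cogen (p ∘ₗ proj))] at h1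
  obtain ⟨s, hs, hs'⟩ := exists_sequence
    (P := fun n (x : (TensorAlgebra k M →ₗ[k] N) × (TensorAlgebra k N →ₗ[k] N)) =>
      IsPartialModel g g' σ σ' b p (n + 1) x.1 x.2)
    (R := fun n x y => VanishesBelow (n + 2) (y.1 - x.1) ∧ VanishesBelow (n + 2) (y.2 - x.2))
    (x := (p ∘ₗ proj, 0)) hbase fun n x hx => by
      obtain ⟨f₂, b₂, h1, h2⟩ := hx.step hg hg' hb hbd hc (by omega)
      exact ⟨(f₂, b₂), h1, h2⟩
  obtain ⟨f, hf, hfd⟩ := exists_graded_limit (fun n => (s n).1)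
    (fun n => (hs' n).1.mono (by omega)) fun n => (hs n).f_isHom
  obtain ⟨b', hb', hbd'⟩ := exists_graded_limit (fun n => (s n).2)
    (fun n => (hs' n).2.mono (by omega)) fun n => (hs n).b_isHom
  have hf1 : f 1 = 0 := by simpa [(hs 1).map_one] using hf 1 [] (by simp)
  have hb2 : VanishesBelow 2 b' := by simpa using (hb' 2).add (hs 2).b_min
  have hb1 : VanishesBelow 1 b' := hb2.mono (by omega)
  have hD' : Shortens 0 (coder σ' b') := shortens_coder _ hb1
  refine ⟨f, b', ⟨hf1, hfd, ?_⟩, ⟨vanishesBelow_one_iff.1 hb1, hbd', ?_⟩, hb2,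
    by simpa using (hf 2).add (hs 2).f_sub⟩
  · rw [← sub_eq_zero]
    refine eq_zero_of_vanishesBelow fun n => ?_
    have h1 : f ∘ₗ coder σ b - b' ∘ₗ cogen f =
        (f - (s (n + 1)).1) ∘ₗ coder σ b - (b' - (s (n + 1)).2) ∘ₗ cogen f -
        (s (n + 1)).2 ∘ₗ (cogen f - cogen (s (n + 1)).1) +
        ((s (n + 1)).1 ∘ₗ coder σ b - (s (n + 1)).2 ∘ₗ cogen (s (n + 1)).1) := by
      simp only [LinearMap.sub_comp, LinearMap.comp_sub]
      abel
    rw [h1]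
    have h2 := (hf (n + 1)).comp (shortens_coder σ (vanishesBelow_one_iff.2 hb.map_one))
    have h3 := (hb' (n + 1)).comp (shortens_cogen hf1)
    have h4 := (hs (n + 1)).b_min.comp (shortens_cogen_sub hf1 (hs (n + 1)).map_one (hf (n + 1)))
    exact (((h2.sub h3).mono (by omega)).sub (h4.mono (by omega))).add
      ((hs (n + 1)).mor.mono (by omega))
  · refine eq_zero_of_vanishesBelow fun n => ?_
    have h1 : b' ∘ₗ coder σ' b' = (b' - (s (n + 1)).2) ∘ₗ coder σ' b' +
        (s (n + 1)).2 ∘ₗ (coder σ' b' - coder σ' (s (n + 1)).2) +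
        (s (n + 1)).2 ∘ₗ coder σ' (s (n + 1)).2 := by
      simp only [LinearMap.sub_comp, LinearMap.comp_sub]
      abel
    rw [h1]
    have h2 := (hb' (n + 1)).comp hD'
    have h3 := (hs (n + 1)).b_min.comp (shortens_coder_sub σ' (hb' (n + 1)))
    exact ((h2.mono (by omega)).add (h3.mono (by omega))).add ((hs (n + 1)).alg.mono (by omega))

/-- An approximation, up to length `r`, to a section of the morphism `f`. -/
structure IsPartialSection (g : ℤ → Submodule k M) (g' : ℤ → Submodule k N)
    (σ' : N →ₗ[k] N) (b : TensorAlgebra k M →ₗ[k] M) (b' : TensorAlgebra k N →ₗ[k] N)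
    (f : TensorAlgebra k M →ₗ[k] N) (i : N →ₗ[k] M) (r : ℕ)
    (u : TensorAlgebra k N →ₗ[k] M) : Prop where
  map_one : u 1 = 0
  isHom : IsHom g' g 0 u
  sub : VanishesBelow 2 (u - i ∘ₗ proj)
  mor : VanishesBelow (r + 1) (u ∘ₗ coder σ' b' - b ∘ₗ cogen u)
  sec : VanishesBelow (r + 1) (f ∘ₗ cogen u - proj)

variable {b' : TensorAlgebra k N →ₗ[k] N} {f : TensorAlgebra k M →ₗ[k] N}

lemma IsPartialSection.step (hg : SignedGrading g σ) (hg' : SignedGrading g' σ')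
    (hb : IsAlg g σ b) (hbd : VanishesBelow 2 (b - d ∘ₗ proj)) (hc : IsContraction g g' d p i h)
    (hb' : IsAlg g' σ' b') (hm : VanishesBelow 2 b') (hf : IsMor g σ b g' b' f)
    (hfp : VanishesBelow 2 (f - p ∘ₗ proj)) {r : ℕ} (hr : 1 ≤ r)
    {u : TensorAlgebra k N →ₗ[k] M} (hu : IsPartialSection g g' σ' b b' f i r u) :
    ∃ u₂, IsPartialSection g g' σ' b b' f i (r + 1) u₂ ∧ VanishesBelow (r + 1) (u₂ - u) := by
  set e := u ∘ₗ coder σ' b' - b ∘ₗ cogen u with he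
  set s := f ∘ₗ cogen u - proj with hs
  set D := coder σ b with hD
  set D' := coder σ' b' with hD'
  set E := cogen u ∘ₗ D' - D ∘ₗ cogen u with hE
  have hσu : u ∘ₗ mapT σ' = σ ∘ₗ u := hu.isHom.comp_mapT_even hg'.iSup_eq hg'.sign hg.sign
  have hEs : Shortens r E := shortens_defect hu.map_one hσu hu.mor
  have hDs : Shortens 1 D' := shortens_coder _ hm
  have hpE : proj ∘ₗ E = e := by
    rw [hE, LinearMap.comp_sub, ← LinearMap.comp_assoc, ← LinearMap.comp_assoc,
      proj_cogen hu.map_one, proj_coder, he]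
  have hDU : Shortens 0 (cogen u) := shortens_cogen hu.map_one
  have hde : VanishesBelow (r + 2) (d ∘ₗ e) := by
    have h1 : d ∘ₗ e = -(e ∘ₗ D') - (b - d ∘ₗ proj) ∘ₗ E := by
      have h2 : e ∘ₗ D' = -(b ∘ₗ E) := by
        rw [he, hE, LinearMap.sub_comp, LinearMap.comp_sub, LinearMap.comp_assoc,
          hb'.coder_coder hg', ← LinearMap.comp_assoc (cogen u) D b, hb.rel]
        simp [LinearMap.comp_assoc]
      rw [h2, LinearMap.sub_comp, LinearMap.comp_assoc, hpE]
      abel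
    rw [h1]
    exact (hu.mor.comp hDs).neg.sub ((hbd.comp hEs).mono (by omega))
  have hfU1 : (f ∘ₗ cogen u) 1 = 0 := by simp [cogen_one hu.map_one, hf.map_one]
  have hpe : VanishesBelow (r + 2) (p ∘ₗ e) := by
    have h1 : p ∘ₗ e =
        s ∘ₗ D' - b' ∘ₗ (cogen (f ∘ₗ cogen u) - cogen proj) - (f - p ∘ₗ proj) ∘ₗ E := by
      have h2 : f ∘ₗ E = s ∘ₗ D' - b' ∘ₗ (cogen (f ∘ₗ cogen u) - cogen proj) := by
        rw [hE, LinearMap.comp_sub, ← LinearMap.comp_assoc (cogen u) D f, hf.rel,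
          LinearMap.comp_assoc (cogen u), cogen_comp_cogen hf.map_one hu.map_one, hs,
          LinearMap.sub_comp, proj_coder, LinearMap.comp_sub, cogen_proj, LinearMap.comp_id,
          LinearMap.comp_assoc]
        abel
      rw [← h2, LinearMap.sub_comp, LinearMap.comp_assoc, hpE]
      abel
    rw [h1]
    have h3 := hm.comp (shortens_cogen_sub hfU1 (by simp) hu.sec)
    exact ((hu.sec.comp hDs).sub (h3.mono (by omega))).sub ((hfp.comp hEs).mono (by omega))
  set t := h ∘ₗ e - i ∘ₗ s - i ∘ₗ (p ∘ₗ (h ∘ₗ e)) with ht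
  have hts : VanishesBelow (r + 1) t :=
    ((hu.mor.linear_comp h).sub (hu.sec.linear_comp i)).sub
      (((hu.mor.linear_comp h).linear_comp p).linear_comp i)
  have hed : IsHom g' g 1 e := by
    have h1 := hu.isHom.comp (IsHom.coder hg'.sign_mem hb'.isHom)
    have h2 := hb.isHom.comp (IsHom.cogen hu.map_one hu.isHom)
    simp only [zero_add, add_zero] at h1 h2
    exact h1.sub h2
  have hi : ∀ n, ∀ x ∈ g' n, i x ∈ g (n + 0) := by simpa using hc.i_mem
  have hp : ∀ n, ∀ x ∈ g n, p x ∈ g' (n + 0) := by simpa using hc.p_mem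
  have hsd : IsHom g' g' 0 s := by
    have h1 := hf.isHom.comp (IsHom.cogen hu.map_one hu.isHom)
    have h2 : IsHom g' g' 0 (LinearMap.id ∘ₗ proj) := IsHom.of_linear (by simp)
    exact h1.sub h2
  have htd : IsHom g' g 0 t := by
    have h1 : IsHom g' g 0 (h ∘ₗ e) := hed.linear_comp hc.h_mem
    exact (h1.sub (hsd.linear_comp hi)).sub ((h1.linear_comp hp).linear_comp hi)
  have hu1 : (u + t) 1 = 0 := by
    have := hts [] (by simp)
    simpa [hu.map_one] using this
  have hUs : Shortens r (cogen (u + t) - cogen u) :=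
    shortens_cogen_sub hu1 hu.map_one (by rwa [add_sub_cancel_left])
  have hpU : proj ∘ₗ (cogen (u + t) - cogen u) = t := by
    rw [LinearMap.comp_sub, proj_cogen hu1, proj_cogen hu.map_one, add_sub_cancel_left]
  have hdt : d ∘ₗ t = e - i ∘ₗ (p ∘ₗ e) - h ∘ₗ (d ∘ₗ e) := by
    have h1 := congrArg (· ∘ₗ e) hc.homotopy
    simp only [LinearMap.add_comp, LinearMap.sub_comp, LinearMap.id_comp] at h1
    rw [ht, LinearMap.comp_sub, LinearMap.comp_sub, ← LinearMap.comp_assoc _ i,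
      ← LinearMap.comp_assoc _ i, hc.di, LinearMap.zero_comp, LinearMap.zero_comp, sub_zero,
      sub_zero, ← LinearMap.comp_assoc, eq_sub_iff_add_eq, ← LinearMap.comp_assoc e d h, h1,
      LinearMap.comp_assoc]
  have hpt : p ∘ₗ t = -s := by
    rw [ht, LinearMap.comp_sub, LinearMap.comp_sub, ← LinearMap.comp_assoc _ i,
      ← LinearMap.comp_assoc _ i, hc.pi, LinearMap.id_comp, LinearMap.id_comp]
    abel
  refine ⟨u + t, ⟨hu1, hu.isHom.add htd, ?_, ?_, ?_⟩, by rwa [add_sub_cancel_left]⟩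
  · rw [add_sub_right_comm]
    exact hu.sub.add (hts.mono (by omega))
  · have h1 : (u + t) ∘ₗ D' - b ∘ₗ cogen (u + t) = i ∘ₗ (p ∘ₗ e) + h ∘ₗ (d ∘ₗ e) + t ∘ₗ D' -
        (b - d ∘ₗ proj) ∘ₗ (cogen (u + t) - cogen u) := by
      have h2 : (b - d ∘ₗ proj) ∘ₗ (cogen (u + t) - cogen u) =
          b ∘ₗ cogen (u + t) - b ∘ₗ cogen u - (e - i ∘ₗ (p ∘ₗ e) - h ∘ₗ (d ∘ₗ e)) := by
        rw [LinearMap.sub_comp, LinearMap.comp_assoc _ proj, hpU, hdt, LinearMap.comp_sub]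
      rw [h2, LinearMap.add_comp]
      have h3 : u ∘ₗ D' = e + b ∘ₗ cogen u := by rw [he, sub_add_cancel]
      rw [h3]
      abel
    rw [h1]
    exact (((hpe.linear_comp i).add (hde.linear_comp h)).add (hts.comp hDs)).sub
      ((hbd.comp hUs).mono (by omega))
  · have h1 : f ∘ₗ cogen (u + t) - proj =
        (f - p ∘ₗ proj) ∘ₗ (cogen (u + t) - cogen u) := by
      rw [LinearMap.sub_comp, LinearMap.comp_assoc _ proj, hpU, hpt, hs, LinearMap.comp_sub]
      abel
    rw [h1]
    exact (hfp.comp hUs).mono (by omega)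

theorem exists_section (hg : SignedGrading g σ) (hg' : SignedGrading g' σ')
    (hb : IsAlg g σ b) (hbd : VanishesBelow 2 (b - d ∘ₗ proj)) (hc : IsContraction g g' d p i h)
    (hb' : IsAlg g' σ' b') (hm : VanishesBelow 2 b') (hf : IsMor g σ b g' b' f)
    (hfp : VanishesBelow 2 (f - p ∘ₗ proj)) :
    ∃ u, IsMor g' σ' b' g b u ∧ VanishesBelow 2 (u - i ∘ₗ proj) := by
  have hpi : (proj : TensorAlgebra k M →ₗ[k] M) ∘ₗ mapT i = i ∘ₗ proj := by
    rw [mapT_eq_cogen, proj_cogen (by simp)]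
  have hbase : IsPartialSection g g' σ' b b' f i 1 (i ∘ₗ proj) := by
    refine ⟨by simp, IsHom.of_linear (c := 0) (by simpa using hc.i_mem), fun l _ => by simp,
      ?_, ?_⟩
    · rw [← mapT_eq_cogen, LinearMap.comp_assoc, proj_coder]
      have h1 := (hm.linear_comp i).sub (hbd.comp (shortens_mapT i))
      rwa [LinearMap.sub_comp, LinearMap.comp_assoc, hpi, ← LinearMap.comp_assoc, hc.di,
        LinearMap.zero_comp, sub_zero] at h1
    · rw [← mapT_eq_cogen]
      have h1 := hfp.comp (shortens_mapT i)
      rwa [LinearMap.sub_comp, LinearMap.comp_assoc, hpi, ← LinearMap.comp_assoc, hc.pi,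
        LinearMap.id_comp] at h1
  obtain ⟨s, hs, hs'⟩ := exists_sequence
    (P := fun n x => IsPartialSection g g' σ' b b' f i (n + 1) x)
    (R := fun n x y => VanishesBelow (n + 2) (y - x)) hbase
    fun n x hx => hx.step hg hg' hb hbd hc hb' hm hf hfp (by omega)
  obtain ⟨u, hu, hud⟩ := exists_graded_limit s (fun n => (hs' n).mono (by omega))
    fun n => (hs n).isHom
  have hu1 : u 1 = 0 := by simpa [(hs 1).map_one] using hu 1 [] (by simp)
  refine ⟨u, ⟨hu1, hud, ?_⟩, by simpa using (hu 2).add (hs 2).sub⟩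
  rw [← sub_eq_zero]
  refine eq_zero_of_vanishesBelow fun n => ?_
  have h1 : u ∘ₗ coder σ' b' - b ∘ₗ cogen u = (u - s (n + 1)) ∘ₗ coder σ' b' -
      b ∘ₗ (cogen u - cogen (s (n + 1))) +
      (s (n + 1) ∘ₗ coder σ' b' - b ∘ₗ cogen (s (n + 1))) := by
    simp only [LinearMap.sub_comp, LinearMap.comp_sub]
    abel
  rw [h1]
  have h2 := (hu (n + 1)).comp (shortens_coder σ' (vanishesBelow_one_iff.2 hb'.map_one))
  have h3 := (vanishesBelow_one_iff.2 hb.map_one).comp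
    (shortens_cogen_sub hu1 (hs (n + 1)).map_one (hu (n + 1)))
  exact ((h2.mono (by omega)).sub (h3.mono (by omega))).add ((hs (n + 1)).mor.mono (by omega))

end Models

lemma IsMor.comp {M N P : Type} [AddCommGroup M] [Module k M] [AddCommGroup N] [Module k N]
    [AddCommGroup P] [Module k P] {g : ℤ → Submodule k M} {g' : ℤ → Submodule k N}
    {g'' : ℤ → Submodule k P} {σ : M →ₗ[k] M} {σ' : N →ₗ[k] N} {b : TensorAlgebra k M →ₗ[k] M}
    {b' : TensorAlgebra k N →ₗ[k] N} {b'' : TensorAlgebra k P →ₗ[k] P}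
    {f : TensorAlgebra k N →ₗ[k] P} {u : TensorAlgebra k M →ₗ[k] N}
    (hg : SignedGrading g σ) (hg' : SignedGrading g' σ')
    (hf : IsMor g' σ' b' g'' b'' f) (hu : IsMor g σ b g' b' u) :
    IsMor g σ b g'' b'' (f ∘ₗ cogen u) := by
  have hσu : u ∘ₗ mapT σ = σ' ∘ₗ u := hu.isHom.comp_mapT_even hg.iSup_eq hg.sign hg'.sign
  refine ⟨by simp [cogen_one hu.map_one, hf.map_one], ?_, ?_⟩
  · simpa using hf.isHom.comp (IsHom.cogen hu.map_one hu.isHom)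
  · rw [LinearMap.comp_assoc, cogen_comp_coder hu.map_one hσu, hu.rel,
      ← coder_comp_cogen σ' b' hu.map_one, ← LinearMap.comp_assoc, hf.rel, LinearMap.comp_assoc,
      cogen_comp_cogen hf.map_one hu.map_one]

section Words

variable {M N : Type} [AddCommGroup M] [Module k M] [AddCommGroup N] [Module k N]
  {g : ℤ → Submodule k M}

lemma homWord_ofFn {n : ℕ} {p : Fin n → ℤ} {v : Fin n → M} (hv : ∀ t, v t ∈ g (p t)) :
    HomWord g (List.ofFn v) (∑ t, p t) := by
  induction n with
  | zero => simpa using .nil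
  | succ n ih =>
    rw [List.ofFn_succ, Fin.sum_univ_succ]
    exact .cons (hv 0) (ih fun t => hv t.succ)

lemma HomWord.exists_ofFn {l : List M} {q : ℤ} (h : HomWord g l q) :
    ∃ (n : ℕ) (p : Fin n → ℤ) (v : Fin n → M), (∀ t, v t ∈ g (p t)) ∧ l = List.ofFn v ∧
      q = ∑ t, p t := by
  induction h with
  | nil => exact ⟨0, Fin.elim0, Fin.elim0, fun t => t.elim0, by simp, by simp⟩
  | @cons x l p q hx _ ih =>
    obtain ⟨n, p', v, hv, rfl, rfl⟩ := ih
    refine ⟨n + 1, Fin.cons p p', Fin.cons x v, fun t => ?_, by simp, by simp [Fin.sum_univ_succ]⟩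
    cases t using Fin.cases with
    | zero => simpa using hx
    | succ t => simpa using hv t

lemma homWord_take_ofFn {n : ℕ} {p : Fin n → ℤ} {v : Fin n → M} (hv : ∀ t, v t ∈ g (p t))
    {i : ℕ} (hi : i ≤ n) : HomWord g ((List.ofFn v).take i) (partialDeg n i p) := by
  induction i with
  | zero => simpa [partialDeg] using HomWord.nil
  | succ i ih =>
    have h1 := (ih (by omega)).append (HomWord.cons (hv ⟨i, hi⟩) .nil)
    have h2 : partialDeg n (i + 1) p = partialDeg n i p + p ⟨i, hi⟩ := by
      rw [partialDeg, Finset.sum_range_succ, dif_pos (Nat.lt_of_succ_le hi)]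
      rfl
    rw [h2, List.take_succ_eq_append_getElem (by simpa using hi)]
    simpa using h1

lemma ofFn_shiftArg {n i j : ℕ} (v : Fin n → M) (h : i + j ≤ n) :
    List.ofFn (shiftArg n i j v) = ((List.ofFn v).drop i).take j := by
  refine List.ext_getElem (by simp; omega) fun t h1 h2 => ?_
  simp only [List.length_ofFn] at h1
  simp [shiftArg, show i + t < n by omega]

lemma ofFn_insArg {n i j : ℕ} (v : Fin n → M) (x : M) (hi : i < n) (hj : 1 ≤ j) (h : i + j ≤ n) :
    List.ofFn (insArg n i j v x) =
      (List.ofFn v).take i ++ x :: ((List.ofFn v).drop i).drop j := by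
  refine List.ext_getElem (by simp; omega) fun t h1 h2 => ?_
  simp only [List.length_ofFn] at h1
  rw [List.getElem_ofFn, List.getElem_append]
  simp only [insArg, List.length_take, List.length_ofFn]
  rcases lt_trichotomy t i with hti | rfl | hti
  · simp [hti, show t < n by omega]
  · simp [min_eq_left hi.le]
  · simp only [min_eq_left hi.le, List.getElem_cons]
    simp [show ¬ t < i by omega, show t ≠ i by omega, show t + j - 1 < n by omega,
      show t - i ≠ 0 by omega]
    congr 2
    omega

/-- The operations of all arities encoded by a linear map on tensor words. -/
noncomputable def ops (φ : TensorAlgebra k M →ₗ[k] N) (n : ℕ) (v : Fin n → M) : N :=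
  φ (word (List.ofFn v))

lemma isMultilinear_ops (φ : TensorAlgebra k M →ₗ[k] N) (n : ℕ) :
    IsMultilinear k (ops φ n) := by
  simp only [IsMultilinear, ops, word_ofFn]
  constructor <;> intros <;> simp

lemma exists_eq_ops {f : ∀ n : ℕ, (Fin n → M) → N} (hf : ∀ n, IsMultilinear k (f n)) :
    ∃ φ : TensorAlgebra k M →ₗ[k] N, f = ops φ := by
  let F : ∀ n : ℕ, MultilinearMap k (fun _ : Fin n => M) N := fun n =>
    { toFun := f n
      map_update_add' := fun v i x y => by
        convert (hf n).1 v i x y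
      map_update_smul' := fun v i a x => by
        convert (hf n).2 v i a x }
  exact ⟨assemble F, by ext n v; exact (assemble_word F v).symm⟩

lemma ops_zero_iff {φ : TensorAlgebra k M →ₗ[k] N} : ops φ 0 = 0 ↔ φ 1 = 0 :=
  ⟨fun h => by simpa [ops] using congrFun h Fin.elim0, fun h => by ext v; simpa [ops] using h⟩

lemma ops_isHom_iff {g' : ℤ → Submodule k N} {φ : TensorAlgebra k M →ₗ[k] N} {c : ℤ} :
    (∀ (n : ℕ) (p : Fin n → ℤ) (v : Fin n → M), (∀ t, v t ∈ g (p t)) →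
      ops φ n v ∈ g' (c + ∑ t, p t)) ↔ IsHom g g' c φ := by
  constructor
  · intro h l q hl
    obtain ⟨n, p, v, hv, rfl, rfl⟩ := hl.exists_ofFn
    rw [add_comm]
    exact h n p v hv
  · intro h n p v hv
    rw [add_comm]
    exact h _ _ (homWord_ofFn hv)

lemma apply_coder_word {σ : M →ₗ[k] M} (hσ : ∀ p, ∀ x ∈ g p, σ x = (-1 : k) ^ p • x)
    {b : TensorAlgebra k M →ₗ[k] M} (hb : b 1 = 0) (φ : TensorAlgebra k M →ₗ[k] N)
    {n : ℕ} {p : Fin n → ℤ} {v : Fin n → M} (hv : ∀ t, v t ∈ g (p t)) :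
    φ (coder σ b (word (List.ofFn v))) =
      ∑ i ∈ Finset.range n, ∑ j ∈ Finset.Icc 1 (n - i), ((-1 : k) ^ partialDeg n i p) •
        ops φ (i + 1 + (n - i - j)) (insArg n i j v (ops b j (shiftArg n i j v))) := by
  have h : ∀ i ≤ n, (((TensorAlgebra.ι k ∘ₗ b) ⋆ LinearMap.id)
      (word (k := k) ((List.ofFn v).drop i))) = ∑ j ∈ Finset.Icc 1 (n - i),
        word (b (word (((List.ofFn v).drop i).take j)) :: ((List.ofFn v).drop i).drop j) := by
    intro i hi
    rw [conv_apply_word, List.length_drop, List.length_ofFn]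
    have : ∀ j, (TensorAlgebra.ι k ∘ₗ b) (word (((List.ofFn v).drop i).take j)) *
        LinearMap.id (R := k) (word (((List.ofFn v).drop i).drop j)) =
        word (b (word (((List.ofFn v).drop i).take j)) :: ((List.ofFn v).drop i).drop j) := by
      intro j; simp
    simp only [this]
    refine (Finset.sum_subset (fun j hj => ?_) fun j hj hj' => ?_).symm
    · simp only [Finset.mem_Icc, Finset.mem_range] at hj ⊢
      omega
    · have : j = 0 := by
        simp only [Finset.mem_Icc, Finset.mem_range] at hj hj'
        omega
      simp [this, hb]
  rw [coder, conv_apply_word, List.length_ofFn, Finset.sum_range_succ, h n le_rfl]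
  simp only [tsub_self, show Finset.Icc 1 0 = ∅ from rfl, Finset.sum_empty, mul_zero, add_zero,
    map_sum]
  refine Finset.sum_congr rfl fun i hi => ?_
  have hin := Finset.mem_range.1 hi
  rw [(homWord_take_ofFn hv hin.le).mapT_sign hσ, h i hin.le, Finset.mul_sum, map_sum]
  refine Finset.sum_congr rfl fun j hj => ?_
  rw [Finset.mem_Icc] at hj
  rw [smul_mul_assoc, ← word_append, map_smul, ops, ops, ofFn_shiftArg v (by omega),
    ofFn_insArg v _ hin hj.1 (by omega)]

/-- The composition with first block `i + 1` and remaining blocks those of `c`. -/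
def consComposition {n : ℕ} (i : Fin n) (c : Composition (n - (i + 1))) : Composition n where
  blocks := (i + 1) :: c.blocks
  blocks_pos := by
    intro j hj
    rcases List.mem_cons.1 hj with rfl | hj
    · omega
    · exact c.blocks_pos hj
  blocks_sum := by
    rw [List.sum_cons, c.blocks_sum]
    omega

lemma sum_composition {P : Type} [AddCommMonoid P] {n : ℕ} (hn : n ≠ 0) (F : Composition n → P) :
    ∑ c, F c = ∑ i : Fin n, ∑ c : Composition (n - (i + 1)), F (consComposition i c) := by
  rw [← Fintype.sum_sigma']
  symm
  refine Fintype.sum_bijective (fun x : Σ i : Fin n, Composition (n - (i + 1)) =>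
    consComposition x.1 x.2) ⟨?_, ?_⟩ _ _ fun _ => rfl
  · rintro ⟨i, c⟩ ⟨j, c'⟩ h
    have h' : ((i : ℕ) + 1) :: c.blocks = ((j : ℕ) + 1) :: c'.blocks :=
      congrArg Composition.blocks h
    rw [List.cons.injEq] at h'
    obtain rfl : i = j := Fin.ext (by omega)
    rw [Composition.ext h'.2]
  · rintro ⟨_ | ⟨a, l⟩, hpos, hsum⟩
    · exact absurd hsum.symm hn
    · have ha : 0 < a := hpos (by simp)
      rw [List.sum_cons] at hsum
      refine ⟨⟨⟨a - 1, by omega⟩, ⟨l, fun h => hpos (List.mem_cons_of_mem _ h), ?_⟩⟩, ?_⟩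
      · simp only; omega
      · apply Composition.ext
        simp [consComposition]
        omega

lemma cogen_word {f : TensorAlgebra k M →ₗ[k] N} (hf : f 1 = 0) {n : ℕ} {l : List M}
    (hl : l.length = n) : cogen f (word l) =
      ∑ c : Composition n, word ((l.splitWrtComposition c).map fun s => f (word s)) := by
  induction n using Nat.strong_induction_on generalizing l with
  | _ n ih =>
    rcases eq_or_ne n 0 with rfl | hn
    · obtain rfl := List.length_eq_zero_iff.1 hl
      have : ∀ c : Composition 0, c.blocks = [] := fun c => by
        exact List.length_eq_zero_iff.1 (by simp)
      simp [composition_card, cogen_one hf, List.splitWrtComposition, this,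
        List.splitWrtCompositionAux]
    · have hone : (convOne : TensorAlgebra k M →ₗ[k] TensorAlgebra k N) (word l) = 0 := by
        cases l with
        | nil => exact absurd hl.symm hn
        | cons x l => simp
      rw [cogen_rec hf, LinearMap.add_apply, hone, zero_add, conv_apply_word,
        Finset.sum_range_succ', hl, sum_composition hn, ← Fin.sum_univ_eq_sum_range]
      simp only [List.take_zero, word_nil, LinearMap.comp_apply, hf, map_zero, zero_mul, add_zero]
      refine Finset.sum_congr rfl fun i _ => ?_
      rw [ih (n - (i + 1)) (by omega) (by simp [hl]), Finset.mul_sum]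
      refine Finset.sum_congr rfl fun c _ => ?_
      simp [List.splitWrtComposition, consComposition, List.splitWrtCompositionAux]

lemma ofFn_embedding {α β : Type} {n : ℕ} (v : Fin n → α) (c : Composition n) (f : List α → β) :
    List.ofFn (fun s => f (List.ofFn fun t => v (c.embedding s t))) =
      ((List.ofFn v).splitWrtComposition c).map f := by
  refine List.ext_getElem (by simp [List.length_splitWrtComposition]) fun s h1 h2 => ?_
  simp only [List.length_ofFn] at h1
  simp only [List.getElem_ofFn, List.getElem_map, List.getElem_splitWrtComposition]
  congr 1
  have h3 := c.sizeUpTo_succ h1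
  have h4 := c.sizeUpTo_le (s + 1)
  refine List.ext_getElem ?_ fun t h5 h6 => ?_
  · simp only [List.length_ofFn, List.length_drop, List.length_take, Composition.blocksFun,
      List.get_eq_getElem]
    omega
  · simp only [List.getElem_ofFn, List.getElem_drop, List.getElem_take]
    rfl

lemma apply_cogen_word {P : Type} [AddCommGroup P] [Module k P]
    {f : TensorAlgebra k M →ₗ[k] N} (hf : f 1 = 0) (φ : TensorAlgebra k N →ₗ[k] P)
    {n : ℕ} (v : Fin n → M) :
    φ (cogen f (word (List.ofFn v))) = ∑ c : Composition n,
      ops φ c.length (fun s => ops f (c.blocksFun s) (fun t => v (c.embedding s t))) := by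
  rw [cogen_word hf (List.length_ofFn), map_sum]
  refine Finset.sum_congr rfl fun c _ => ?_
  simp only [ops]
  rw [ofFn_embedding v c fun l => f (word l)]

end Words

section Bridge

variable {M N : Type} [AddCommGroup M] [Module k M] [AddCommGroup N] [Module k N]
  {g : ℤ → Submodule k M} {g' : ℤ → Submodule k N} {σ : M →ₗ[k] M}
  {b : TensorAlgebra k M →ₗ[k] M} {b' : TensorAlgebra k N →ₗ[k] N}
  {f : TensorAlgebra k M →ₗ[k] N}

lemma isAInfinity_ops_iff (hg : SignedGrading g σ) :
    IsAInfinity k M g (ops b) ↔ IsAlg g σ b := by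
  constructor
  · rintro ⟨h0, -, h1, h2⟩
    have hb := ops_zero_iff.1 h0
    refine ⟨hb, ops_isHom_iff.1 h1, homWord_ext hg.iSup_eq fun l q hl => ?_⟩
    obtain ⟨n, p, v, hv, rfl, rfl⟩ := hl.exists_ofFn
    rw [LinearMap.comp_apply, apply_coder_word hg.sign hb b hv, LinearMap.zero_apply]
    rcases Nat.eq_zero_or_pos n with rfl | hn
    · simp
    · exact h2 n hn p v hv
  · intro h
    refine ⟨ops_zero_iff.2 h.map_one, isMultilinear_ops b, ops_isHom_iff.2 h.isHom,
      fun n _ p v hv => ?_⟩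
    rw [← apply_coder_word hg.sign h.map_one b hv]
    exact LinearMap.congr_fun h.rel _

lemma isAInfMorphism_ops_iff (hg : SignedGrading g σ) (hb : b 1 = 0) (hb' : b' 1 = 0) :
    IsAInfMorphism k M g (ops b) N g' (ops b') (ops f) ↔ IsMor g σ b g' b' f := by
  constructor
  · rintro ⟨h0, -, h1, h2⟩
    have hf := ops_zero_iff.1 h0
    refine ⟨hf, ops_isHom_iff.1 (by simpa using h1), homWord_ext hg.iSup_eq fun l q hl => ?_⟩
    obtain ⟨n, p, v, hv, rfl, rfl⟩ := hl.exists_ofFn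
    rcases Nat.eq_zero_or_pos n with rfl | hn
    · simp [coder_one σ hb, cogen_one hf, hb']
    · rw [LinearMap.comp_apply, LinearMap.comp_apply, apply_coder_word hg.sign hb f hv,
        apply_cogen_word hf]
      exact h2 n hn p v hv
  · intro h
    refine ⟨ops_zero_iff.2 h.map_one, isMultilinear_ops f,
      by simpa using ops_isHom_iff.2 h.isHom, fun n _ p v hv => ?_⟩
    rw [← apply_coder_word hg.sign hb f hv, ← apply_cogen_word h.map_one]
    exact LinearMap.congr_fun h.rel _

end Bridge

section Linear

variable {M N : Type} [AddCommGroup M] [Module k M] [AddCommGroup N] [Module k N]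
  {g : ℤ → Submodule k M} {g' : ℤ → Submodule k N}

lemma exists_linearMap_of_isInternal (hg : DirectSum.IsInternal g) (φ : ∀ n, g n →ₗ[k] N) :
    ∃ ψ : M →ₗ[k] N, ∀ n x (hx : x ∈ g n), ψ x = φ n ⟨x, hx⟩ := by
  let e := LinearEquiv.ofBijective (DirectSum.coeLinearMap g) hg
  refine ⟨DirectSum.toModule k ℤ N φ ∘ₗ e.symm.toLinearMap, fun n x hx => ?_⟩
  have : e.symm x = DirectSum.lof k ℤ (fun n => g n) n ⟨x, hx⟩ := by
    rw [LinearEquiv.symm_apply_eq]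
    exact (DirectSum.coeLinearMap_lof g n ⟨x, hx⟩).symm
  simp [this]

lemma exists_signedGrading (hg : DirectSum.IsInternal g) : ∃ σ, SignedGrading g σ := by
  obtain ⟨σ, hσ⟩ := exists_linearMap_of_isInternal hg fun n => (-1 : k) ^ n • (g n).subtype
  exact ⟨σ, hg.submodule_iSup_eq_top, fun n x hx => by simp [hσ n x hx]⟩

lemma exists_pseudoInverse (a : M →ₗ[k] N) : ∃ s : N →ₗ[k] M, ∀ x, a (s (a x)) = a x := by
  obtain ⟨s, hs⟩ := a.rangeRestrict.exists_rightInverse_of_surjective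
    (LinearMap.range_rangeRestrict a)
  obtain ⟨t, ht⟩ := s.exists_extend
  refine ⟨t, fun x => ?_⟩
  have h1 : t (a x) = s (a.rangeRestrict x) := LinearMap.congr_fun ht (a.rangeRestrict x)
  rw [h1]
  exact congrArg Subtype.val (LinearMap.congr_fun hs (a.rangeRestrict x))

lemma exists_graded_pseudoInverse (hg : DirectSum.IsInternal g) {d : M →ₗ[k] M}
    (hd : ∀ n, ∀ x ∈ g n, d x ∈ g (n + 1)) :
    ∃ s : M →ₗ[k] M, (∀ n, ∀ x ∈ g n, s x ∈ g (n + -1)) ∧ d ∘ₗ (s ∘ₗ d) = d := by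
  choose S hS using fun n => exists_pseudoInverse (d ∘ₗ (g (n + -1)).subtype)
  obtain ⟨s, hs⟩ := exists_linearMap_of_isInternal hg
    fun n => (g (n + -1)).subtype ∘ₗ (S n ∘ₗ (g n).subtype)
  refine ⟨s, fun n x hx => by simp [hs n x hx], ?_⟩
  ext x
  have hx : x ∈ ⨆ n, g n := hg.submodule_iSup_eq_top ▸ Submodule.mem_top
  induction hx using Submodule.iSup_induction' with
  | mem n x hx =>
    have := hS (n + 1) ⟨x, by simpa using hx⟩
    simpa [hs _ _ (hd n x hx)] using this
  | zero => simp
  | add x y _ _ hx hy => rw [map_add, map_add, hx, hy]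

lemma exists_isContraction (hg : DirectSum.IsInternal g) {d : M →ₗ[k] M} {p : M →ₗ[k] N}
    {i : N →ₗ[k] M} (d_mem : ∀ n, ∀ x ∈ g n, d x ∈ g (n + 1)) (p_mem : ∀ n, ∀ x ∈ g n, p x ∈ g' n)
    (i_mem : ∀ n, ∀ x ∈ g' n, i x ∈ g n) (dd : d ∘ₗ d = 0) (pd : p ∘ₗ d = 0) (di : d ∘ₗ i = 0)
    (pi : p ∘ₗ i = LinearMap.id)
    (hexact : ∀ n, ∀ x ∈ g n, d x = 0 → p x = 0 → ∃ y, d y = x) :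
    ∃ h, IsContraction g g' d p i h := by
  obtain ⟨s, s_mem, hs⟩ := exists_graded_pseudoInverse hg d_mem
  replace dd := fun x => LinearMap.congr_fun dd x
  replace hs := fun x => LinearMap.congr_fun hs x
  have pd' := fun x => LinearMap.congr_fun pd x
  have di' := fun x => LinearMap.congr_fun di x
  have pi' := fun x => LinearMap.congr_fun pi x
  simp only [LinearMap.comp_apply, LinearMap.zero_apply, LinearMap.id_apply] at dd hs pd' di' pi'
  set q : M →ₗ[k] M := LinearMap.id - i ∘ₗ p with hq
  have q_mem : ∀ n, ∀ x ∈ g n, q x ∈ g n := fun n x hx => sub_mem hx (i_mem _ _ (p_mem _ _ hx))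
  have qd : ∀ x, q (d x) = d x := fun x => by simp [hq, pd']
  have dq : ∀ x, d (q x) = d x := fun x => by simp [hq, di']
  have qq : ∀ x, q (q x) = q x := fun x => by simp [hq, pi']
  have pq : ∀ x, p (q x) = 0 := fun x => by simp [hq, pi']
  refine ⟨q ∘ₗ s ∘ₗ q ∘ₗ (LinearMap.id - q ∘ₗ s ∘ₗ d), d_mem, p_mem, i_mem,
    fun n x hx => ?_, pd, di, pi, ?_⟩
  · have h1 := q_mem _ _ (s_mem _ _ (d_mem n x hx))
    rw [add_neg_cancel_right] at h1
    exact q_mem _ _ (s_mem _ _ (q_mem _ _ (sub_mem hx h1)))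
  · rw [← hq]
    ext x
    have hx : x ∈ ⨆ n, g n := hg.submodule_iSup_eq_top ▸ Submodule.mem_top
    induction hx using Submodule.iSup_induction' with
    | mem n x hx =>
      have h1 := q_mem _ _ (s_mem _ _ (d_mem n x hx))
      rw [add_neg_cancel_right] at h1
      obtain ⟨y, hy⟩ := hexact n (q (x - q (s (d x)))) (q_mem _ _ (sub_mem hx h1))
        (by rw [dq, map_sub, dq, hs, sub_self]) (pq _)
      have h2 : d (q (s (d y))) = d y := by rw [dq, hs]
      simp only [LinearMap.add_apply, LinearMap.comp_apply, LinearMap.sub_apply,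
        LinearMap.id_apply, dd, map_zero, sub_zero, qd]
      rw [← hy, h2, hy, map_sub, qq, sub_add_cancel]
    | zero => simp
    | add x y _ _ hx hy => rw [map_add, map_add, hx, hy]

end Linear

section Homology

variable (A : AInfAlg k)

lemma d₁_mem (n : ℤ) (x : A.M) (hx : x ∈ A.gr n) : d₁ A x ∈ A.gr (n + 1) := by
  have := A.isAInf.2.2.1 1 (fun _ => n) (fun _ => x) fun _ => hx
  rw [add_comm]
  change A.b 1 (fun _ => x) ∈ _
  simpa using this

lemma exists_signedGrading_homology : ∃ σ, SignedGrading (grH A) σ := by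
  refine ⟨DirectSum.toModule k ℤ _ fun n => (-1 : k) ^ n • DirectSum.lof k ℤ (Hp A) n, ?_, ?_⟩
  · rw [eq_top_iff]
    intro x _
    induction x using DirectSum.induction_on with
    | zero => exact zero_mem _
    | of n x => exact Submodule.mem_iSup_of_mem n ⟨x, rfl⟩
    | add x y hx hy => exact add_mem (hx trivial) (hy trivial)
  · rintro n _ ⟨x, rfl⟩
    simp

/-- The projection from the cycles of degree `n` to the homology of degree `n`. -/
noncomputable def toHp (n : ℤ) : cyc A n →ₗ[k] Hp A n :=
  Submodule.mkQ (Submodule.comap (cyc A n).subtype (bdry A n))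

lemma range_toHp (n : ℤ) : LinearMap.range (toHp A n) = ⊤ := Submodule.range_mkQ _

lemma lof_toHp (n : ℤ) (x : cyc A n) :
    DirectSum.lof k ℤ (fun q => Hp A q) n (toHp A n x) = cls A n x x.2 := rfl

variable {A}

lemma cls_eq_zero_iff {n : ℤ} {x : A.M} {hx : x ∈ cyc A n} : cls A n x hx = 0 ↔ x ∈ bdry A n := by
  have : Function.Injective (DirectSum.lof k ℤ (fun q => Hp A q) n) := DirectSum.of_injective _
  rw [← lof_toHp A n ⟨x, hx⟩, map_eq_zero_iff _ this]
  exact Submodule.Quotient.mk_eq_zero _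

/-- `p` sends every cycle to its homology class. -/
def IsCycleProjection (p : A.M →ₗ[k] HM A) : Prop :=
  ∀ n x (hx : x ∈ cyc A n), p x = cls A n x hx

variable (A)

lemma exists_isCycleProjection (dd : d₁ A ∘ₗ d₁ A = 0) :
    ∃ p : A.M →ₗ[k] HM A, IsCycleProjection p ∧ (∀ n, ∀ x ∈ A.gr n, p x ∈ grH A n) ∧
      p ∘ₗ d₁ A = 0 := by
  choose c hc using fun n => (toHp A n).exists_extend
  obtain ⟨p, hp⟩ := exists_linearMap_of_isInternal A.internal
    fun n => DirectSum.lof k ℤ (Hp A) n ∘ₗ (c n ∘ₗ (A.gr n).subtype)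
  have hcls : IsCycleProjection p := fun n x hx => by
    rw [hp n x hx.1]
    exact congrArg (DirectSum.lof k ℤ (Hp A) n) (LinearMap.congr_fun (hc n) ⟨x, hx⟩)
  refine ⟨p, hcls, fun n x hx => hp n x hx ▸ ⟨_, rfl⟩, ?_⟩
  ext x : 1
  have hx : x ∈ ⨆ n, A.gr n := A.internal.submodule_iSup_eq_top ▸ Submodule.mem_top
  induction hx using Submodule.iSup_induction' with
  | mem n x hx =>
    have h1 : d₁ A x ∈ cyc A (n + 1) :=
      ⟨d₁_mem A n x hx, LinearMap.mem_ker.2 (LinearMap.congr_fun dd x)⟩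
    rw [LinearMap.comp_apply, hcls _ _ h1, LinearMap.zero_apply, cls_eq_zero_iff]
    exact ⟨x, by simpa using hx, rfl⟩
  | zero => simp
  | add x y _ _ hx hy => rw [map_add, map_add, hx, hy]

lemma exists_cycle_section :
    ∃ i : HM A →ₗ[k] A.M, (∀ n, ∀ x ∈ grH A n, i x ∈ A.gr n) ∧ d₁ A ∘ₗ i = 0 ∧
      ∀ p : A.M →ₗ[k] HM A, IsCycleProjection p → p ∘ₗ i = LinearMap.id := by
  choose s hs using fun n => (toHp A n).exists_rightInverse_of_surjective (range_toHp A n)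
  refine ⟨DirectSum.toModule k ℤ _ fun n => (cyc A n).subtype ∘ₗ s n, ?_, ?_, fun p hp => ?_⟩
  · rintro n _ ⟨x, rfl⟩
    simpa using (s n x).2.1
  · refine DirectSum.linearMap_ext k fun n => LinearMap.ext fun x => ?_
    simpa using (s n x).2.2
  · refine DirectSum.linearMap_ext k fun n => LinearMap.ext fun x => ?_
    simp only [LinearMap.comp_apply, DirectSum.toModule_lof, LinearMap.id_apply,
      Submodule.subtype_apply]
    rw [hp n _ (s n x).2, ← lof_toHp]
    exact congrArg (DirectSum.lof k ℤ (Hp A) n) (LinearMap.congr_fun (hs n) x)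

variable {A}

lemma IsCycleProjection.exists_isContraction {p : A.M →ₗ[k] HM A} (hp : IsCycleProjection p)
    (p_mem : ∀ n, ∀ x ∈ A.gr n, p x ∈ grH A n) (pd : p ∘ₗ d₁ A = 0) (dd : d₁ A ∘ₗ d₁ A = 0)
    {i : HM A →ₗ[k] A.M} (i_mem : ∀ n, ∀ x ∈ grH A n, i x ∈ A.gr n) (di : d₁ A ∘ₗ i = 0)
    (pi : p ∘ₗ i = LinearMap.id) :
    ∃ h, IsContraction A.gr (grH A) (d₁ A) p i h := by
  refine Stmt13.exists_isContraction A.internal (d₁_mem A) p_mem i_mem dd pd di pi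
    fun n x hx hdx hpx => ?_
  have hxc : x ∈ cyc A n := ⟨hx, LinearMap.mem_ker.2 hdx⟩
  rw [hp n x hxc, cls_eq_zero_iff] at hpx
  obtain ⟨y, -, hy⟩ := hpx
  exact ⟨y, hy⟩

end Homology

section LowArity

variable {M N : Type} [AddCommGroup M] [Module k M] [AddCommGroup N] [Module k N]

lemma ops_one (φ : TensorAlgebra k M →ₗ[k] N) (v : Fin 1 → M) :
    ops φ 1 v = φ (TensorAlgebra.ι k (v 0)) := by
  simp [ops]

lemma ops_two (φ : TensorAlgebra k M →ₗ[k] N) (x y : M) :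
    ops φ 2 ![x, y] = φ (TensorAlgebra.ι k x * TensorAlgebra.ι k y) := by
  simp [ops]

lemma vanishesBelow_two_iff {φ : TensorAlgebra k M →ₗ[k] N} :
    VanishesBelow 2 φ ↔ φ 1 = 0 ∧ ∀ x, φ (TensorAlgebra.ι k x) = 0 := by
  refine ⟨fun h => ⟨h [] (by simp), fun x => by simpa using h [x] (by simp)⟩, fun h l hl => ?_⟩
  match l, hl with
  | [], _ => simpa using h.1
  | [x], _ => simpa using h.2 x

lemma coder_ι (σ : M →ₗ[k] M) {b : TensorAlgebra k M →ₗ[k] M} (hb : b 1 = 0) (x : M) :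
    coder σ b (TensorAlgebra.ι k x) = TensorAlgebra.ι k (b (TensorAlgebra.ι k x)) := by
  rw [← word_singleton, coder, conv_apply_word]
  have h1 : ((TensorAlgebra.ι k ∘ₗ b) ⋆ LinearMap.id) (TensorAlgebra.ι k x) =
      TensorAlgebra.ι k (b (TensorAlgebra.ι k x)) := by
    rw [← word_singleton, conv_apply_word]
    simp [Finset.sum_range_succ, hb]
  simp [Finset.sum_range_succ, h1, hb]

lemma cogen_ι {f : TensorAlgebra k M →ₗ[k] N} (hf : f 1 = 0) (x : M) :
    cogen f (TensorAlgebra.ι k x) = TensorAlgebra.ι k (f (TensorAlgebra.ι k x)) := by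
  rw [← word_singleton, cogen_rec hf, LinearMap.add_apply, conv_apply_word]
  have h1 : (convOne : TensorAlgebra k M →ₗ[k] TensorAlgebra k N) (TensorAlgebra.ι k x) = 0 := by
    simpa using convOne_cons (M := M) x 1
  simp [Finset.sum_range_succ, hf, cogen_one hf, h1]

end LowArity

section Final

variable {M N : Type} [AddCommGroup M] [Module k M] [AddCommGroup N] [Module k N]
  {g : ℤ → Submodule k M} {g' : ℤ → Submodule k N} {σ : M →ₗ[k] M}
  {b : TensorAlgebra k M →ₗ[k] M} {b' : TensorAlgebra k N →ₗ[k] N}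
  {f : TensorAlgebra k M →ₗ[k] N}

/-- A morphism to a minimal structure carries the product of two cycles to the product of their
images. -/
lemma IsMor.map_two (hf : IsMor g σ b g' b' f) (hb : b 1 = 0) (hb' : VanishesBelow 2 b') {x y : M}
    (hx : b (TensorAlgebra.ι k x) = 0) (hy : b (TensorAlgebra.ι k y) = 0) :
    f (TensorAlgebra.ι k (b (TensorAlgebra.ι k x * TensorAlgebra.ι k y))) =
      b' (TensorAlgebra.ι k (f (TensorAlgebra.ι k x)) *
        TensorAlgebra.ι k (f (TensorAlgebra.ι k y))) := by
  have h := LinearMap.congr_fun hf.rel (word [x, y])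
  have h1 : ((TensorAlgebra.ι k ∘ₗ b) ⋆ LinearMap.id) (TensorAlgebra.ι k y) = 0 := by
    rw [← word_singleton, conv_apply_word]
    simp [Finset.sum_range_succ, hb, hy]
  have h2 : ((TensorAlgebra.ι k ∘ₗ b) ⋆ LinearMap.id) (TensorAlgebra.ι k x * TensorAlgebra.ι k y) =
      TensorAlgebra.ι k (b (TensorAlgebra.ι k x * TensorAlgebra.ι k y)) := by
    rw [← word_singleton y, ← word_cons, conv_apply_word]
    simp [Finset.sum_range_succ, hb, hx]
  have h3 : coder σ b (word [x, y]) =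
      TensorAlgebra.ι k (b (TensorAlgebra.ι k x * TensorAlgebra.ι k y)) := by
    rw [coder, conv_apply_word]
    simp [Finset.sum_range_succ, h1, h2, hb]
  have h4 : cogen f (word [x, y]) = TensorAlgebra.ι k (f (TensorAlgebra.ι k x)) *
        TensorAlgebra.ι k (f (TensorAlgebra.ι k y)) +
      TensorAlgebra.ι k (f (TensorAlgebra.ι k x * TensorAlgebra.ι k y)) := by
    rw [cogen_rec hf.map_one, LinearMap.add_apply, conv_apply_word, word_cons, convOne_cons]
    simp [Finset.sum_range_succ, hf.map_one, cogen_one hf.map_one, cogen_ι hf.map_one]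
  rw [LinearMap.comp_apply, LinearMap.comp_apply, h3, h4, map_add,
    (vanishesBelow_two_iff.1 hb').2, add_zero] at h
  exact h

end Final

section MinimalModel

variable {A : AInfAlg k} {σ : A.M →ₗ[k] A.M} {σ' : HM A →ₗ[k] HM A}
  {β : TensorAlgebra k A.M →ₗ[k] A.M} {b' : TensorAlgebra k (HM A) →ₗ[k] HM A}
  {f : TensorAlgebra k A.M →ₗ[k] HM A}

lemma apply_ι_eq_d₁ (hβ : A.b = ops β) (x : A.M) : β (TensorAlgebra.ι k x) = d₁ A x := by
  rw [← ops_one β fun _ => x, ← hβ]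
  rfl

lemma IsAlg.vanishesBelow_sub (hA : IsAlg A.gr σ β) (hβ : A.b = ops β) :
    VanishesBelow 2 (β - d₁ A ∘ₗ proj) :=
  vanishesBelow_two_iff.2 ⟨by simp [hA.map_one], fun x => by simp [apply_ι_eq_d₁ hβ]⟩

lemma IsAlg.d₁_comp_d₁ (hA : IsAlg A.gr σ β) (hβ : A.b = ops β) : d₁ A ∘ₗ d₁ A = 0 := by
  ext x
  have := LinearMap.congr_fun hA.rel (TensorAlgebra.ι k x)
  rw [LinearMap.comp_apply, coder_ι σ hA.map_one, apply_ι_eq_d₁ hβ, apply_ι_eq_d₁ hβ] at this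
  simpa using this

lemma exists_isMinimalModelStructure (hg : SignedGrading A.gr σ) (hg' : SignedGrading (grH A) σ')
    (hA : IsAlg A.gr σ β) (hβ : A.b = ops β) :
    ∃ bH : ∀ n : ℕ, (Fin n → HM A) → HM A, IsMinimalModelStructure A bH := by
  have dd := hA.d₁_comp_d₁ hβ
  obtain ⟨p, hp, p_mem, pd⟩ := exists_isCycleProjection A dd
  obtain ⟨i, i_mem, di, pi⟩ := exists_cycle_section A
  obtain ⟨h, hc⟩ := hp.exists_isContraction p_mem pd dd i_mem di (pi p hp)
  obtain ⟨f, b', hf, hb', hm, hfp⟩ :=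
    exists_minimal_model hg hg' hA (hA.vanishesBelow_sub hβ) hc
  have hfx : ∀ x, f (TensorAlgebra.ι k x) = p x := fun x => by
    simpa [sub_eq_zero] using (vanishesBelow_two_iff.1 hfp).2 x
  refine ⟨ops b', (isAInfinity_ops_iff hg').2 hb', ?_, fun n m x y hx hy hb => ?_, ops f, ?_,
    fun n x hx => ?_⟩
  · ext1 v
    rw [ops_one, (vanishesBelow_two_iff.1 hm).2]
    rfl
  · have := hf.map_two hA.map_one hm (x := x) (y := y)
      ((apply_ι_eq_d₁ hβ x).trans hx.2) ((apply_ι_eq_d₁ hβ y).trans hy.2)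
    rw [hfx, hfx, hfx, hp n x hx, hp m y hy, ← ops_two, ← hβ, hp _ _ hb, ← ops_two] at this
    exact this.symm
  · rw [hβ]
    exact (isAInfMorphism_ops_iff hg hA.map_one hb'.map_one).2 hf
  · rw [ops_one, hfx, hp n x hx]

lemma IsMinimalModelStructure.exists_isMor (hg : SignedGrading A.gr σ)
    (hg' : SignedGrading (grH A) σ') (hA : IsAlg A.gr σ β) (hβ : A.b = ops β)
    {bH : ∀ n : ℕ, (Fin n → HM A) → HM A} (hH : IsMinimalModelStructure A bH) :
    ∃ b' f, bH = ops b' ∧ IsAlg (grH A) σ' b' ∧ VanishesBelow 2 b' ∧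
      IsMor A.gr σ β (grH A) b' f ∧ IsCycleProjection (f ∘ₗ TensorAlgebra.ι k) := by
  obtain ⟨halg, hone, -, F, hF, hcls⟩ := hH
  obtain ⟨b', rfl⟩ := exists_eq_ops halg.2.1
  obtain ⟨f, rfl⟩ := exists_eq_ops hF.2.1
  have hb' := (isAInfinity_ops_iff hg').1 halg
  rw [hβ, isAInfMorphism_ops_iff hg hA.map_one hb'.map_one] at hF
  refine ⟨b', f, rfl, hb', vanishesBelow_two_iff.2 ⟨hb'.map_one, fun x => ?_⟩, hF,
    fun n x hx => ?_⟩
  · rw [← ops_one b' fun _ => x, hone]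
    rfl
  · rw [← hcls n x hx, ops_one]
    rfl

lemma IsMor.comp_d₁ (hf : IsMor A.gr σ β (grH A) b' f) (hA : IsAlg A.gr σ β) (hβ : A.b = ops β)
    (hm : VanishesBelow 2 b') : (f ∘ₗ TensorAlgebra.ι k) ∘ₗ d₁ A = 0 := by
  ext1 x
  have := LinearMap.congr_fun hf.rel (TensorAlgebra.ι k x)
  rw [LinearMap.comp_apply, LinearMap.comp_apply, coder_ι σ hA.map_one, cogen_ι hf.map_one,
    (vanishesBelow_two_iff.1 hm).2, apply_ι_eq_d₁ hβ] at this
  exact this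

lemma IsMor.apply_ι_mem (hf : IsMor A.gr σ β (grH A) b' f) (n : ℤ) (x : A.M) (hx : x ∈ A.gr n) :
    (f ∘ₗ TensorAlgebra.ι k) x ∈ grH A n := by
  have := hf.isHom [x] n (by simpa using HomWord.cons hx .nil)
  simpa using this

lemma IsMor.exists_section (hg : SignedGrading A.gr σ) (hg' : SignedGrading (grH A) σ')
    (hA : IsAlg A.gr σ β) (hβ : A.b = ops β) (hb' : IsAlg (grH A) σ' b') (hm : VanishesBelow 2 b')
    (hf : IsMor A.gr σ β (grH A) b' f) (hp : IsCycleProjection (f ∘ₗ TensorAlgebra.ι k))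
    {i : HM A →ₗ[k] A.M} (i_mem : ∀ n, ∀ x ∈ grH A n, i x ∈ A.gr n) (di : d₁ A ∘ₗ i = 0)
    (pi : (f ∘ₗ TensorAlgebra.ι k) ∘ₗ i = LinearMap.id) :
    ∃ u, IsMor (grH A) σ' b' A.gr β u ∧ ∀ x, u (TensorAlgebra.ι k x) = i x := by
  obtain ⟨h, hc⟩ := hp.exists_isContraction hf.apply_ι_mem (hf.comp_d₁ hA hβ hm)
    (hA.d₁_comp_d₁ hβ) i_mem di pi
  obtain ⟨u, hu, hui⟩ := Stmt13.exists_section hg hg' hA (hA.vanishesBelow_sub hβ) hc hb' hm hf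
    (vanishesBelow_two_iff.2 ⟨by simp [hf.map_one], fun x => by simp⟩)
  exact ⟨u, hu, fun x => by simpa [sub_eq_zero] using (vanishesBelow_two_iff.1 hui).2 x⟩

lemma IsMinimalModelStructure.exists_isomorphism (hg : SignedGrading A.gr σ)
    (hg' : SignedGrading (grH A) σ') (hA : IsAlg A.gr σ β) (hβ : A.b = ops β)
    {bH bH' : ∀ n : ℕ, (Fin n → HM A) → HM A} (hH : IsMinimalModelStructure A bH)
    (hH' : IsMinimalModelStructure A bH') :
    ∃ F : ∀ n : ℕ, (Fin n → HM A) → HM A,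
      IsAInfMorphism k (HM A) (grH A) bH (HM A) (grH A) bH' F ∧
      Function.Bijective (fun x => F 1 fun _ => x) := by
  obtain ⟨b₁, f₁, rfl, hb₁, hm₁, hf₁, hp₁⟩ := hH.exists_isMor hg hg' hA hβ
  obtain ⟨b₂, f₂, rfl, hb₂, hm₂, hf₂, hp₂⟩ := hH'.exists_isMor hg hg' hA hβ
  obtain ⟨i, i_mem, di, pi⟩ := exists_cycle_section A
  obtain ⟨u, hu, hui⟩ := hf₁.exists_section hg hg' hA hβ hb₁ hm₁ hp₁ i_mem di (pi _ hp₁)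
  refine ⟨ops (f₂ ∘ₗ cogen u), (isAInfMorphism_ops_iff hg' hb₁.map_one hb₂.map_one).2
    (IsMor.comp hg' hg hf₂ hu), ?_⟩
  convert Function.bijective_id using 1
  ext1 x
  rw [ops_one, LinearMap.comp_apply, cogen_ι hu.map_one, hui]
  exact LinearMap.congr_fun (pi _ hp₂) x

end MinimalModel

/-- **Statement 13 (minimal model theorem).**  `H*A` carries a minimal A∞-structure with
`b₁ = 0`, `b₂` induced from `b₂` of `A`, and an A∞-quasi-isomorphism `A → H*A` inducing
the identity in homology; moreover any two such structures are related by an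
A∞-isomorphism. -/
theorem minimal_model (A : AInfAlg k) :
    (∃ bH : ∀ n : ℕ, (Fin n → HM A) → HM A, IsMinimalModelStructure A bH) ∧
    (∀ bH bH' : ∀ n : ℕ, (Fin n → HM A) → HM A,
      IsMinimalModelStructure A bH → IsMinimalModelStructure A bH' →
      ∃ g : ∀ n : ℕ, (Fin n → HM A) → HM A,
        IsAInfMorphism k (HM A) (grH A) bH (HM A) (grH A) bH' g ∧
        Function.Bijective (fun x => g 1 fun _ => x)) := by
  obtain ⟨β, hβ⟩ := exists_eq_ops A.isAInf.2.1
  obtain ⟨σ, hg⟩ := exists_signedGrading A.internal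
  obtain ⟨σ', hg'⟩ := exists_signedGrading_homology A
  have hA : IsAlg A.gr σ β := (isAInfinity_ops_iff hg).1 (hβ ▸ A.isAInf)
  exact ⟨exists_isMinimalModelStructure hg hg' hA hβ,
    fun _ _ hH hH' => hH.exists_isomorphism hg hg' hA hβ hH'⟩

end Stmt13
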